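/- arXiv:1105.0072 — 9 statements merged into one kernel-verified Lean document; each statement's English description precedes it below -/
import Mathlib

section
/- Let K be a perfect field of characteristic p > 0, let S = K[x_1, …, x_n] be a polynomial ring, let I ⊆ S be an ideal, let e ≥ 1 be an integer and set q = p^e. Then for every additive map ψ : S/I → S/I satisfying ψ(ā^q · b̄) = ā · ψ(b̄) for all ā, b̄ ∈ S/I, there exist an element s ∈ (I^{[q]} :_S I) and an additive map Φ : S → S satisfying Φ(a^q · b) = a · Φ(b) for all a, b ∈ S, such that ψ(b + I) = Φ(s·b) + I for every b ∈ S. -/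
/-- The `q`-th Frobenius power `J^{[q]}` of an ideal: the ideal generated by
`q`-th powers of elements of `J`. -/
noncomputable def frobPow {R : Type*} [CommRing R] (J : Ideal R) (q : ℕ) : Ideal R :=
  Ideal.span ((fun a => a ^ q) '' (J : Set R))

open MvPolynomial

/-- If every `f` expands along `v` and along `u` with coefficients given by a `q⁻¹`-linear map `T`,
then every `q⁻¹`-linear endomorphism of `R ⧸ I` is induced by `T` twisted by an element of
`(I^{[q]} : I)`. -/
theorem exists_mem_colon_frobPow_of_expansion {R ι : Type*} [CommRing R] [Fintype ι]
    (I : Ideal R) (q : ℕ) (u v : ι → R) (T : R →+ R)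
    (hT : ∀ a b, T (a ^ q * b) = a * T b)
    (hu : ∀ f, f = ∑ i, T (f * v i) ^ q * u i)
    (hv : ∀ f, f = ∑ i, T (f * u i) ^ q * v i)
    (ψ : R ⧸ I →+ R ⧸ I) (hψ : ∀ a b, ψ (a ^ q * b) = a * ψ b) :
    ∃ s ∈ (frobPow I q).colon I,
      ∀ b, ψ (Ideal.Quotient.mk I b) = Ideal.Quotient.mk I (T (s * b)) := by
  choose c hc using fun i => Ideal.Quotient.mk_surjective (ψ (Ideal.Quotient.mk I (u i)))
  have key : ∀ b, ψ (Ideal.Quotient.mk I b) =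
      Ideal.Quotient.mk I (T ((∑ i, c i ^ q * v i) * b)) := by
    intro b
    conv_lhs => rw [hu b]
    simp only [map_sum, map_mul, map_pow, hψ, Finset.sum_mul, mul_assoc, hT, hc]
    exact Finset.sum_congr rfl fun i _ => by rw [mul_comm b, mul_comm]
  refine ⟨_, ?_, key⟩
  rw [Submodule.mem_colon]
  intro x hx
  rw [smul_eq_mul, hv (_ * x)]
  refine Ideal.sum_mem _ fun i _ => Ideal.mul_mem_right _ _ (Ideal.subset_span ⟨_, ?_, rfl⟩)
  rw [SetLike.mem_coe, ← Ideal.Quotient.eq_zero_iff_mem, mul_assoc, ← key,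
    Ideal.Quotient.eq_zero_iff_mem.mpr (Ideal.mul_mem_right _ _ hx), map_zero]

theorem MvPolynomial.exists_addMonoidHom_monomial {σ K M : Type*} [CommSemiring K]
    [AddCommMonoid M] (g : (σ →₀ ℕ) → K →+ M) :
    ∃ T : MvPolynomial σ K →+ M, ∀ d c, T (monomial d c) = g d c :=
  ⟨(Finsupp.liftAddHom g).comp
      (AddMonoidAlgebra.coeffAddEquiv (R := K) (M := σ →₀ ℕ)).toAddMonoidHom,
    fun d c => Finsupp.liftAddHom_apply_single g d c⟩

/-- The trace-like generator of the `q⁻¹`-linear endomorphisms of a polynomial ring over a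
perfect field: it sends `c ^ q * x ^ (q * m + (q - 1))` to `c * x ^ m` and kills every monomial
whose exponents are not all congruent to `q - 1` modulo `q`. -/
theorem MvPolynomial.exists_frobenius_trace {σ : Type*} [Finite σ] (p : ℕ) [Fact p.Prime]
    (K : Type*) [Field K] [CharP K p] [PerfectRing K p] (e : ℕ) :
    ∃ T : MvPolynomial σ K →+ MvPolynomial σ K,
      (∀ d m c, (∀ i, d i = p ^ e * m i + (p ^ e - 1)) →
        T (monomial d (c ^ p ^ e)) = monomial m c) ∧
      ∀ d c, (∃ i, d i % p ^ e ≠ p ^ e - 1) → T (monomial d c) = 0 := by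
  classical
  have hq : 0 < p ^ e := pow_pos (Fact.out : p.Prime).pos e
  obtain ⟨T, hT⟩ := exists_addMonoidHom_monomial (σ := σ) (K := K) (M := MvPolynomial σ K)
    fun d => if ∀ i, d i % p ^ e = p ^ e - 1 then
      (monomial (Finsupp.equivFunOnFinite.symm fun i => d i / p ^ e)).toAddMonoidHom.comp
        (iterateFrobeniusEquiv K p e).symm.toAddMonoidHom else 0
  refine ⟨T, fun d m c h => ?_, fun d c h => ?_⟩
  · have hmod : ∀ i, d i % p ^ e = p ^ e - 1 := fun i => by
      rw [h, Nat.mul_add_mod, Nat.mod_eq_of_lt (by omega)]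
    have hdiv : (Finsupp.equivFunOnFinite.symm fun i => d i / p ^ e) = m := by
      ext i
      simp [h, Nat.mul_add_div hq, Nat.div_eq_of_lt (show p ^ e - 1 < p ^ e by omega)]
    have hc : (iterateFrobeniusEquiv K p e).symm (c ^ p ^ e) = c := by
      rw [RingEquiv.symm_apply_eq, iterateFrobeniusEquiv_apply, iterateFrobenius_def]
    rw [hT, if_pos hmod, hdiv]
    simp [hc]
  · rw [hT, if_neg (by push Not; exact h), AddMonoidHom.zero_apply]

theorem MvPolynomial.map_pow_mul_of_frobenius_trace {σ : Type*} [Finite σ] (p : ℕ)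
    [Fact p.Prime] {K : Type*} [Field K] [CharP K p] [PerfectRing K p] (e : ℕ)
    (T : MvPolynomial σ K →+ MvPolynomial σ K)
    (h₁ : ∀ d m c, (∀ i, d i = p ^ e * m i + (p ^ e - 1)) →
        T (monomial d (c ^ p ^ e)) = monomial m c)
    (h₀ : ∀ d c, (∃ i, d i % p ^ e ≠ p ^ e - 1) → T (monomial d c) = 0)
    (a b : MvPolynomial σ K) : T (a ^ p ^ e * b) = a * T b := by
  induction a using MvPolynomial.induction_on' with
  | add a a' ha ha' => rw [add_pow_char_pow, add_mul, map_add, ha, ha', add_mul]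
  | monomial k α =>
    induction b using MvPolynomial.induction_on' with
    | add b b' hb hb' => rw [mul_add, map_add, hb, hb', map_add, mul_add]
    | monomial d c =>
      rw [monomial_pow, monomial_mul]
      by_cases h : ∀ i, d i % p ^ e = p ^ e - 1
      · obtain ⟨c, rfl⟩ := (bijective_iterateFrobenius K p e).surjective c
        have hd : ∀ i, d i = p ^ e * (d i / p ^ e) + (p ^ e - 1) := fun i => by
          rw [← h i, Nat.div_add_mod]
        rw [iterateFrobenius_def, ← mul_pow,
          h₁ d (Finsupp.equivFunOnFinite.symm fun i => d i / p ^ e) c hd,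
          h₁ _ (k + Finsupp.equivFunOnFinite.symm fun i => d i / p ^ e), monomial_mul]
        intro i
        simp only [Finsupp.add_apply, Finsupp.smul_apply, smul_eq_mul,
          Finsupp.equivFunOnFinite_symm_apply_apply]
        rw [mul_add, add_assoc, ← hd]
      · push Not at h
        rw [h₀ d c h, mul_zero, h₀]
        obtain ⟨i, hi⟩ := h
        exact ⟨i, by simpa [Nat.mul_add_mod] using hi⟩

theorem MvPolynomial.eq_sum_frobenius_trace {σ : Type*} [Fintype σ] (p : ℕ) [Fact p.Prime]
    {K : Type*} [Field K] [CharP K p] [PerfectRing K p] (e : ℕ)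
    (T : MvPolynomial σ K →+ MvPolynomial σ K)
    (h₁ : ∀ d m c, (∀ i, d i = p ^ e * m i + (p ^ e - 1)) →
        T (monomial d (c ^ p ^ e)) = monomial m c)
    (h₀ : ∀ d c, (∃ i, d i % p ^ e ≠ p ^ e - 1) → T (monomial d c) = 0)
    {ι : Type*} [Fintype ι] (u v : ι → σ →₀ ℕ)
    (huv : ∀ r i, u r i + v r i = p ^ e - 1)
    (hu : ∀ k : σ → ℕ, (∀ i, k i < p ^ e) → ∃! r, ∀ i, u r i = k i) (f : MvPolynomial σ K) :
    f = ∑ r, T (f * monomial (v r) 1) ^ p ^ e * monomial (u r) 1 := by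
  classical
  have hq : 0 < p ^ e := pow_pos (Fact.out : p.Prime).pos e
  induction f using MvPolynomial.induction_on' with
  | add f g hf hg =>
    conv_lhs => rw [hf, hg]
    simp only [add_mul, map_add, add_pow_char_pow, Finset.sum_add_distrib]
  | monomial k c =>
    obtain ⟨c, rfl⟩ := (bijective_iterateFrobenius K p e).surjective c
    obtain ⟨r, hr, hr'⟩ := hu (fun i => k i % p ^ e) fun i => Nat.mod_lt _ hq
    rw [Finset.sum_eq_single r, monomial_mul, mul_one, iterateFrobenius_def,
      h₁ _ (Finsupp.equivFunOnFinite.symm fun i => k i / p ^ e), monomial_pow, monomial_mul, mul_one]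
    · congr 2
      ext i
      simp [hr, Nat.div_add_mod]
    · intro i
      have := Nat.div_add_mod (k i) (p ^ e)
      have := hr i
      have := huv r i
      simp only [Finsupp.add_apply, Finsupp.equivFunOnFinite_symm_apply_apply]
      omega
    · intro t _ ht
      rw [monomial_mul, h₀, zero_pow hq.ne', zero_mul]
      by_contra! h
      refine ht (hr' t fun i => ?_)
      have h_mod := h i
      have h_sum := huv t i
      rw [Finsupp.add_apply] at h_mod
      have : k i + v t i + (u t i + 1) ≡ p ^ e - 1 + (u t i + 1) [MOD p ^ e] :=
        Nat.ModEq.add_right _ (by rw [Nat.ModEq, h_mod, Nat.mod_eq_of_lt (by omega)])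
      rw [show k i + v t i + (u t i + 1) = k i + p ^ e by omega,
        show p ^ e - 1 + (u t i + 1) = u t i + p ^ e by omega] at this
      simpa [Nat.ModEq, Nat.mod_eq_of_lt (show u t i < p ^ e by omega)] using this.symm
    · simp

/-- surjectivity part of Fedder's lemma. Let `K` be a perfect field of
characteristic `p > 0`, `S = K[x_1, …, x_n]`, `I ⊆ S` an ideal, `e ≥ 1` and `q = p^e`.
Every additive map `ψ : S/I → S/I` with `ψ(a^q · b) = a · ψ(b)` lifts to a pair of an
element `s ∈ (I^{[q]} : I)` and an additive map `Φ : S → S` with `Φ(a^q · b) = a · Φ(b)`,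
such that `ψ(b + I) = Φ(s·b) + I` for all `b ∈ S`. -/
theorem stmt_0 (p : ℕ) [Fact p.Prime] (K : Type*) [Field K] [CharP K p] [PerfectRing K p]
    (n : ℕ) (I : Ideal (MvPolynomial (Fin n) K)) (e : ℕ) (he : 1 ≤ e)
    (ψ : (MvPolynomial (Fin n) K ⧸ I) →+ (MvPolynomial (Fin n) K ⧸ I))
    (hψ : ∀ a b : MvPolynomial (Fin n) K ⧸ I, ψ (a ^ p ^ e * b) = a * ψ b) :
    ∃ s ∈ (frobPow I (p ^ e)).colon I,
      ∃ Φ : MvPolynomial (Fin n) K →+ MvPolynomial (Fin n) K,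
        (∀ a b : MvPolynomial (Fin n) K, Φ (a ^ p ^ e * b) = a * Φ b) ∧
        ∀ b : MvPolynomial (Fin n) K,
          ψ (Ideal.Quotient.mk I b) = Ideal.Quotient.mk I (Φ (s * b)) := by
  obtain ⟨T, h₁, h₀⟩ := exists_frobenius_trace (σ := Fin n) p K e
  let u : (Fin n → Fin (p ^ e)) → Fin n →₀ ℕ := fun r => Finsupp.equivFunOnFinite.symm fun i => r i
  let v : (Fin n → Fin (p ^ e)) → Fin n →₀ ℕ := fun r =>
    Finsupp.equivFunOnFinite.symm fun i => (r i).rev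
  have huv : ∀ r i, u r i + v r i = p ^ e - 1 := fun r i => by
    have := (r i).isLt
    simp only [u, v, Finsupp.equivFunOnFinite_symm_apply_apply, Fin.val_rev]
    omega
  have hu : ∀ k : Fin n → ℕ, (∀ i, k i < p ^ e) → ∃! r, ∀ i, u r i = k i := fun k hk =>
    ⟨fun i => ⟨k i, hk i⟩, fun i => rfl, fun r hr => funext fun i => Fin.ext (hr i)⟩
  have hv : ∀ k : Fin n → ℕ, (∀ i, k i < p ^ e) → ∃! r, ∀ i, v r i = k i := fun k hk =>
    ⟨fun i => Fin.rev ⟨k i, hk i⟩, fun i => by simp [v, -Fin.val_rev],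
      fun r hr => funext fun i => by rw [← Fin.rev_inj, Fin.rev_rev]; exact Fin.ext (hr i)⟩
  have hT := map_pow_mul_of_frobenius_trace p e T h₁ h₀
  obtain ⟨s, hs, h⟩ := exists_mem_colon_frobPow_of_expansion I (p ^ e)
    (fun r => monomial (u r) 1) (fun r => monomial (v r) 1) T hT
    (eq_sum_frobenius_trace p e T h₁ h₀ u v huv hu)
    (eq_sum_frobenius_trace p e T h₁ h₀ v u (fun r i => by rw [add_comm, huv]) hv) ψ hψ
  exact ⟨s, hs, T, hT, h⟩
end

section
/- Let K be a perfect field of characteristic p > 0, let S = K[x_1, …, x_n], let I ⊆ S be an ideal, let 𝔪 ⊆ S be a maximal ideal containing I, let 𝔞_1, …, 𝔞_r ⊆ S be ideals, let t_1, …, t_r ≥ 0 be real numbers and let e_0 ≥ 1 be an integer. Then (I^{[p^{e_0}]} :_S I) · 𝔞_1^{⌈t_1(p^{e_0}−1)⌉} ⋯ 𝔞_r^{⌈t_r(p^{e_0}−1)⌉} ⊄ 𝔪^{[p^{e_0}]} if and only if for every integer n ≥ 1 one has (I^{[p^{n e_0}]} :_S I) · 𝔞_1^{⌈t_1(p^{n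 e_0}−1)⌉} ⋯ 𝔞_r^{⌈t_r(p^{n e_0}−1)⌉} ⊄ 𝔪^{[p^{n e_0}]}. -/
section FrobeniusRing

variable {R : Type*} [CommRing R] (p : ℕ) [ExpChar R p]

theorem frobPow_eq_map (e : ℕ) (J : Ideal R) :
    frobPow J (p ^ e) = J.map (iterateFrobenius R p e) := rfl

theorem map_iterateFrobenius_map (d e : ℕ) (J : Ideal R) :
    (J.map (iterateFrobenius R p d)).map (iterateFrobenius R p e) =
      J.map (iterateFrobenius R p (e + d)) := by
  rw [Ideal.map_map, iterateFrobenius_add]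

theorem map_iterateFrobenius_le_pow (e : ℕ) (J : Ideal R) :
    J.map (iterateFrobenius R p e) ≤ J ^ p ^ e := by
  refine Ideal.map_le_iff_le_comap.2 fun a ha => ?_
  rw [Ideal.mem_comap, iterateFrobenius_def]
  exact Ideal.pow_mem_pow ha _

theorem colon_mul_le (N J : Ideal R) : N.colon (J : Set R) * J ≤ N :=
  Ideal.mul_le.2 fun _ hr _ hs => Submodule.mem_colon.1 hr _ hs

theorem le_colon_of_mul_le {L N J : Ideal R} (h : L * J ≤ N) : L ≤ N.colon (J : Set R) :=
  fun _ hr => Submodule.mem_colon.2 fun _ hs => h (Ideal.mul_mem_mul hr hs)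

theorem map_colon_mul_colon_le (d e : ℕ) (J : Ideal R) :
    ((J.map (iterateFrobenius R p d)).colon (J : Set R)).map (iterateFrobenius R p e) *
        (J.map (iterateFrobenius R p e)).colon (J : Set R) ≤
      (J.map (iterateFrobenius R p (e + d))).colon (J : Set R) := by
  refine le_colon_of_mul_le ?_
  rw [mul_assoc]
  refine (Ideal.mul_mono_right (colon_mul_le _ _)).trans ?_
  rw [← Ideal.map_mul, ← map_iterateFrobenius_map]
  exact Ideal.map_mono (colon_mul_le _ _)

theorem ceil_mul_sub_one_le (t a b : ℝ) (q : ℕ) (hq : b = q) :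
    ⌈t * (b * a - 1)⌉₊ ≤ q * ⌈t * (a - 1)⌉₊ + ⌈t * (b - 1)⌉₊ := by
  rw [Nat.ceil_le]
  push_cast
  have h₁ := Nat.le_ceil (t * (a - 1))
  have h₂ := Nat.le_ceil (t * (b - 1))
  have h₃ := mul_le_mul_of_nonneg_left h₁ (Nat.cast_nonneg (α := ℝ) q)
  subst hq
  linarith

theorem map_prod_pow_ceil_mul_le {ι : Type*} [Fintype ι] (𝔞 : ι → Ideal R) (t : ι → ℝ)
    (d e : ℕ) :
    (∏ i, 𝔞 i ^ ⌈t i * ((p : ℝ) ^ d - 1)⌉₊).map (iterateFrobenius R p e) *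
        ∏ i, 𝔞 i ^ ⌈t i * ((p : ℝ) ^ e - 1)⌉₊ ≤
      ∏ i, 𝔞 i ^ ⌈t i * ((p : ℝ) ^ (e + d) - 1)⌉₊ := by
  rw [← Ideal.mapHom_apply, map_prod, ← Finset.prod_mul_distrib]
  refine Finset.prod_le_prod' fun i _ => ?_
  rw [map_pow, Ideal.mapHom_apply]
  refine (Ideal.mul_mono_left
    (Ideal.pow_right_mono (map_iterateFrobenius_le_pow p e (𝔞 i)) _)).trans ?_
  rw [← pow_mul, ← pow_add, pow_add (p : ℝ)]
  exact Ideal.pow_le_pow_right (ceil_mul_sub_one_le _ _ _ (p ^ e) (by push_cast; rfl))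

/-- A Frobenius power of a maximal ideal is primary to it. -/
theorem mem_of_mul_mem_map_iterateFrobenius {𝔪 : Ideal R} (hm : 𝔪.IsMaximal) (e : ℕ) {f x : R}
    (hf : f ∉ 𝔪.map (iterateFrobenius R p e))
    (hx : f * x ∈ 𝔪.map (iterateFrobenius R p e)) : x ∈ 𝔪 := by
  by_contra hxm
  obtain ⟨y, z, hz, hyz⟩ := hm.exists_inv hxm
  have h := congrArg (iterateFrobenius R p e) hyz
  have hz' := Ideal.mem_map_of_mem (iterateFrobenius R p e) hz
  rw [map_add, map_mul, map_one] at h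
  refine hf ?_
  have hx' : f * iterateFrobenius R p e x ∈ 𝔪.map (iterateFrobenius R p e) := by
    obtain ⟨k, hk⟩ := Nat.exists_eq_succ_of_ne_zero
      (expChar_pow_pos R p e).ne'
    rw [iterateFrobenius_def, hk, pow_succ', ← mul_assoc]
    exact Ideal.mul_mem_right _ _ hx
  have hf' : f = iterateFrobenius R p e y * (f * iterateFrobenius R p e x) +
      f * iterateFrobenius R p e z := by
    linear_combination (-f) * h
  rw [hf']
  exact add_mem (Ideal.mul_mem_left _ _ hx') (Ideal.mul_mem_left _ _ hz')

end FrobeniusRing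

section FrobeniusRoot

open MvPolynomial

variable {σ K : Type*} [Field K] (p : ℕ) [ExpChar K p] [PerfectRing K p]

open Classical in
/-- The `a`-th coordinate of a polynomial in the monomial basis of `K[σ]` over the image of the
`e`-th iterate of Frobenius, as an additive map. -/
noncomputable def frobeniusCoord (e : ℕ) (a : σ → Fin (p ^ e)) :
    MvPolynomial σ K →+ MvPolynomial σ K :=
  (Finsupp.liftAddHom fun m : σ →₀ ℕ =>
    if ∀ i, m i % p ^ e = a i then
      (monomial (m.mapRange (· / p ^ e) (Nat.zero_div _))).toAddMonoidHom.comp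
        (iterateFrobeniusEquiv K p e).symm.toAddMonoidHom
    else 0).comp AddMonoidAlgebra.coeffAddEquiv.toAddMonoidHom

open Classical in
theorem frobeniusCoord_monomial (e : ℕ) (a : σ → Fin (p ^ e)) (m : σ →₀ ℕ) (c : K) :
    frobeniusCoord p e a (monomial m c) =
      if ∀ i, m i % p ^ e = a i then
        monomial (m.mapRange (· / p ^ e) (Nat.zero_div _))
          ((iterateFrobeniusEquiv K p e).symm c)
      else 0 := by
  have h : (AddMonoidAlgebra.coeffAddEquiv (monomial m c) : (σ →₀ ℕ) →₀ K) =
      Finsupp.single m c := rfl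
  simp only [frobeniusCoord, AddMonoidHom.comp_apply, h,
    Finsupp.liftAddHom_apply_single, AddEquiv.toAddMonoidHom_eq_coe, AddMonoidHom.coe_coe]
  split_ifs <;> rfl

theorem frobeniusCoord_mul (e : ℕ) (a : σ → Fin (p ^ e)) (s u : MvPolynomial σ K) :
    frobeniusCoord p e a (iterateFrobenius _ p e s * u) = s * frobeniusCoord p e a u := by
  classical
  have hq : 0 < p ^ e := expChar_pow_pos K p e
  induction s using MvPolynomial.induction_on' with
  | add s₁ s₂ h₁ h₂ => rw [map_add, add_mul, map_add, h₁, h₂, add_mul]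
  | monomial m c =>
    induction u using MvPolynomial.induction_on' with
    | add u₁ u₂ h₁ h₂ => rw [mul_add, map_add, h₁, h₂, map_add, mul_add]
    | monomial k d =>
      have hroot : (iterateFrobeniusEquiv K p e).symm (c ^ p ^ e) = c := by
        rw [← iterateFrobeniusEquiv_def, RingEquiv.symm_apply_apply]
      have hdiv : (p ^ e • m + k).mapRange (· / p ^ e) (Nat.zero_div _) =
          m + k.mapRange (· / p ^ e) (Nat.zero_div _) := by
        ext i
        simp [Nat.mul_add_div hq]
      rw [iterateFrobenius_def, monomial_pow, monomial_mul, frobeniusCoord_monomial,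
        frobeniusCoord_monomial, hdiv, map_mul, hroot, mul_ite, monomial_mul, mul_zero]
      simp only [Finsupp.add_apply, Finsupp.smul_apply, smul_eq_mul, Nat.mul_add_mod]

theorem sum_iterateFrobenius_frobeniusCoord [Fintype σ] [DecidableEq σ] (e : ℕ) (g : MvPolynomial σ K) :
    ∑ a : σ → Fin (p ^ e), iterateFrobenius _ p e (frobeniusCoord p e a g) *
      monomial (Finsupp.equivFunOnFinite.symm fun i => (a i : ℕ)) 1 = g := by
  have hq : 0 < p ^ e := expChar_pow_pos K p e
  induction g using MvPolynomial.induction_on' with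
  | add g₁ g₂ h₁ h₂ =>
    conv_rhs => rw [← h₁, ← h₂]
    simp only [map_add, add_mul, Finset.sum_add_distrib]
  | monomial m c =>
    rw [Finset.sum_eq_single fun i => ⟨m i % p ^ e, Nat.mod_lt _ hq⟩]
    · have hroot : (iterateFrobeniusEquiv K p e).symm c ^ p ^ e = c := by
        rw [← iterateFrobeniusEquiv_def, RingEquiv.apply_symm_apply]
      rw [frobeniusCoord_monomial, if_pos fun _ => rfl, iterateFrobenius_def, monomial_pow,
        monomial_mul, hroot, mul_one]
      congr 2
      ext i
      simp [Nat.div_add_mod]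
    · intro a _ ha
      rw [frobeniusCoord_monomial, if_neg, map_zero, zero_mul]
      exact fun h => ha (funext fun i => Fin.ext (h i).symm)
    · simp

theorem frobeniusCoord_mem (e : ℕ) (a : σ → Fin (p ^ e)) {J : Ideal (MvPolynomial σ K)}
    {g : MvPolynomial σ K} (hg : g ∈ J.map (iterateFrobenius _ p e)) :
    frobeniusCoord p e a g ∈ J := by
  suffices h : ∀ r, frobeniusCoord p e a (r * g) ∈ J by simpa using h 1
  rw [Ideal.map] at hg
  induction hg using Submodule.span_induction with
  | mem x hx =>
    obtain ⟨y, hy, rfl⟩ := hx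
    intro r
    rw [mul_comm, frobeniusCoord_mul]
    exact Ideal.mul_mem_right _ _ hy
  | zero => simp
  | add x y _ _ hx hy =>
    intro r
    rw [mul_add, map_add]
    exact add_mem (hx r) (hy r)
  | smul s x _ hx =>
    intro r
    rw [smul_eq_mul, ← mul_assoc]
    exact hx _

/-- Flatness of Frobenius: `(J^{[q]} : f^q) ⊆ (J : f)^{[q]}`. -/
theorem mem_map_iterateFrobenius_of_mul_mem [Fintype σ] [DecidableEq σ] (e : ℕ) {J L : Ideal (MvPolynomial σ K)}
    {f g : MvPolynomial σ K} (hL : ∀ x, f * x ∈ J → x ∈ L)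
    (hg : iterateFrobenius _ p e f * g ∈ J.map (iterateFrobenius _ p e)) :
    g ∈ L.map (iterateFrobenius _ p e) := by
  rw [← sum_iterateFrobenius_frobeniusCoord p e g]
  refine sum_mem fun a _ => Ideal.mul_mem_right _ _ (Ideal.mem_map_of_mem _ (hL _ ?_))
  rw [← frobeniusCoord_mul]
  exact frobeniusCoord_mem p e a hg

/-- If `A ⊄ 𝔪^{[p^d]}` and `B ⊄ 𝔪^{[p^e]}`, then `A^{[p^e]} B ⊄ 𝔪^{[p^(e+d)]}`. -/
theorem not_map_iterateFrobenius_mul_le [Fintype σ] [DecidableEq σ] {𝔪 A B : Ideal (MvPolynomial σ K)}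
    (hm : 𝔪.IsMaximal) {d e : ℕ} (hA : ¬A ≤ 𝔪.map (iterateFrobenius _ p d))
    (hB : ¬B ≤ 𝔪.map (iterateFrobenius _ p e)) :
    ¬A.map (iterateFrobenius _ p e) * B ≤ 𝔪.map (iterateFrobenius _ p (e + d)) := by
  obtain ⟨f, hfA, hf⟩ := SetLike.not_le_iff_exists.1 hA
  refine fun h => hB fun g hg => mem_map_iterateFrobenius_of_mul_mem p e
    (fun x hx => mem_of_mul_mem_map_iterateFrobenius p hm d hf hx) ?_
  rw [map_iterateFrobenius_map]
  exact h (Ideal.mul_mem_mul (Ideal.mem_map_of_mem _ hfA) hg)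

end FrobeniusRoot

/-- the parenthetical equivalence in Lemma 1.4(2). For a perfect field `K`
of characteristic `p > 0`, `S = K[x_1, …, x_n]`, an ideal `I`, a maximal ideal `𝔪 ⊇ I`,
ideals `𝔞_1, …, 𝔞_r`, reals `t_i ≥ 0` and `e₀ ≥ 1`:
`(I^{[p^{e₀}]} : I) · ∏ 𝔞_i^{⌈t_i(p^{e₀}−1)⌉} ⊄ 𝔪^{[p^{e₀}]}`
iff the same non-containment holds with `e₀` replaced by `n·e₀` for every `n ≥ 1`. -/
theorem stmt_1 (p : ℕ) [Fact p.Prime] (K : Type*) [Field K] [CharP K p] [PerfectRing K p]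
    (n : ℕ) (I 𝔪 : Ideal (MvPolynomial (Fin n) K)) (hm : 𝔪.IsMaximal) (hIm : I ≤ 𝔪)
    (r : ℕ) (𝔞 : Fin r → Ideal (MvPolynomial (Fin n) K))
    (t : Fin r → ℝ) (ht : ∀ i, 0 ≤ t i) (e₀ : ℕ) (he₀ : 1 ≤ e₀) :
    ¬((frobPow I (p ^ e₀)).colon I * ∏ i, 𝔞 i ^ ⌈t i * ((p : ℝ) ^ e₀ - 1)⌉₊
        ≤ frobPow 𝔪 (p ^ e₀)) ↔
    ∀ n' : ℕ, 1 ≤ n' →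
      ¬((frobPow I (p ^ (n' * e₀))).colon I *
          ∏ i, 𝔞 i ^ ⌈t i * ((p : ℝ) ^ (n' * e₀) - 1)⌉₊
        ≤ frobPow 𝔪 (p ^ (n' * e₀))) := by
  refine ⟨fun h n' hn' => ?_, fun h => by simpa using h 1 le_rfl⟩
  simp only [frobPow_eq_map p] at h ⊢
  induction n', hn' using Nat.le_induction with
  | base => simpa using h
  | succ k _ ih =>
    rw [Nat.succ_mul, add_comm (k * e₀)]
    refine fun hle => not_map_iterateFrobenius_mul_le p hm ih h (le_trans ?_ hle)
    rw [Ideal.map_mul, mul_mul_mul_comm]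
    exact Ideal.mul_mono (map_colon_mul_colon_le p _ _ I) (map_prod_pow_ceil_mul_le p 𝔞 t _ _)
end

section
/- Let K be a perfect field of characteristic p > 0, let S = K[x_1, …, x_n], let I ⊆ S be an ideal, let 𝔪 ⊆ S be a maximal ideal containing I, let 𝔞_1, …, 𝔞_r ⊆ S be ideals none of which is contained in any minimal prime of I, and let t_1, …, t_r ≥ 0 be real numbers. Let R denote the localization of S/I at the maximal ideal 𝔪/I. Then the following are equivalent: (a) there exist an integer e ≥ 1, an element δ of the image of 𝔞_1^{⌈t_1(p^e−1)⌉} ⋯ 𝔞_r^{⌈t_r(p^e−1)⌉} in R, and an additive map ψ : R → R satisfying ψ(a^{p^e} · b) = a · ψ(b) for all a, b ∈ R and ψ(δ) = 1; (b) there exists an integer e ≥ 1 such that (I^{[p^e]} :_S I) · 𝔞_1^{⌈t_1(p^e−1)⌉} ⋯ 𝔞_r^{⌈t_r(p^e−1)⌉} ⊄ 𝔪^{[p^e]}. -/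
section FrobeniusPower

variable {S : Type*} [CommRing S] {q : ℕ}

theorem pow_mem_frobPow {J : Ideal S} {a : S} (ha : a ∈ J) : a ^ q ∈ frobPow J q :=
  Ideal.subset_span ⟨a, ha, rfl⟩

/-- A `1/q`-linear map sends `J^{[q]}` into `J`. -/
theorem map_mem_of_mem_frobPow {J : Ideal S} (φ : S →+ S)
    (hφ : ∀ a b, φ (a ^ q * b) = a * φ b) {g : S} (hg : g ∈ frobPow J q) : φ g ∈ J := by
  suffices ∀ b, φ (b * g) ∈ J by simpa using this 1
  refine Submodule.span_induction ?_ (by simp) ?_ ?_ hg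
  · rintro _ ⟨a, ha, rfl⟩ b
    rw [mul_comm, hφ]
    exact J.mul_mem_right _ ha
  · intro x y _ _ hx hy b
    rw [mul_add, map_add]
    exact J.add_mem (hx b) (hy b)
  · intro a x _ hx b
    rw [smul_eq_mul, ← mul_assoc]
    exact hx _

/-- `J^{[q]}` contains every element all of whose coordinates lie in `J`. -/
theorem mem_frobPow_of_forall_coord_mem {ι : Type*} [Fintype ι] {x y : ι → S} {Φ : S → S}
    (hΦ : ∀ g, g = ∑ i, Φ (y i * g) ^ q * x i) {J : Ideal S} {g : S}
    (hg : ∀ i, Φ (y i * g) ∈ J) : g ∈ frobPow J q := by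
  rw [hΦ g]
  exact Ideal.sum_mem _ fun i _ => Ideal.mul_mem_right _ _ (pow_mem_frobPow (hg i))

end FrobeniusPower

section PolynomialTrace

variable {p : ℕ} [Fact p.Prime] {K : Type*} [Field K] [CharP K p] [PerfectRing K p] {n : ℕ}

open MvPolynomial

open Classical in
/-- The additive map `K[x_1, …, x_n] → K[x_1, …, x_n]` taking the coordinate at
`(x_1 ⋯ x_n)^{p^e - 1}` in the monomial basis over `p^e`-th powers. -/
noncomputable def polynomialTrace (p : ℕ) [Fact p.Prime] (K : Type*) [Field K] [CharP K p]
    [PerfectRing K p] (n e : ℕ) : MvPolynomial (Fin n) K →+ MvPolynomial (Fin n) K :=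
  (Finsupp.liftAddHom fun m : Fin n →₀ ℕ =>
    if ∀ i, m i % p ^ e = p ^ e - 1 then
      ((monomial (m.mapRange (· / p ^ e) (Nat.zero_div _)) : K →ₗ[K] _) : K →+ _).comp
        ((iterateFrobeniusEquiv K p e).symm : K →+ K)
    else 0).comp AddMonoidAlgebra.coeffAddEquiv.toAddMonoidHom

open Classical in
theorem polynomialTrace_monomial (e : ℕ) (m : Fin n →₀ ℕ) (c : K) :
    polynomialTrace p K n e (monomial m c) =
      if ∀ i, m i % p ^ e = p ^ e - 1 then
        monomial (m.mapRange (· / p ^ e) (Nat.zero_div _)) ((iterateFrobeniusEquiv K p e).symm c)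
      else 0 := by
  have : AddMonoidAlgebra.coeffAddEquiv (monomial m c) = Finsupp.single m c := rfl
  simp only [polynomialTrace, AddMonoidHom.comp_apply]
  erw [this]
  rw [Finsupp.liftAddHom_apply_single]
  split_ifs <;> rfl

theorem polynomialTrace_pow_mul (e : ℕ) (a b : MvPolynomial (Fin n) K) :
    polynomialTrace p K n e (a ^ p ^ e * b) = a * polynomialTrace p K n e b := by
  have hq : 0 < p ^ e := pow_pos (Fact.out : p.Prime).pos e
  induction b using MvPolynomial.induction_on' with
  | add b₁ b₂ h₁ h₂ => rw [mul_add, map_add, h₁, h₂, map_add, mul_add]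
  | monomial m c =>
    induction a using MvPolynomial.induction_on' with
    | add a₁ a₂ h₁ h₂ => rw [add_pow_char_pow, add_mul, map_add, h₁, h₂, add_mul]
    | monomial k d =>
      classical
      rw [monomial_pow, monomial_mul, polynomialTrace_monomial, polynomialTrace_monomial]
      simp only [Finsupp.add_apply, Finsupp.smul_apply, smul_eq_mul, Nat.mul_add_mod]
      split_ifs with h
      · rw [monomial_mul, map_mul]
        refine congrArg₂ (fun a b => monomial a b) ?_ ?_
        · ext i
          simp [Nat.mul_add_div hq]
        · rw [← iterateFrobeniusEquiv_def, RingEquiv.symm_apply_apply]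
      · rw [mul_zero]

theorem eq_sum_polynomialTrace (e : ℕ) (g : MvPolynomial (Fin n) K) :
    g = ∑ β : Fin n → Fin (p ^ e),
      polynomialTrace p K n e
        (monomial (Finsupp.equivFunOnFinite.symm fun i => p ^ e - 1 - (β i : ℕ)) 1 * g) ^ p ^ e *
      monomial (Finsupp.equivFunOnFinite.symm fun i => (β i : ℕ)) 1 := by
  have hq : 0 < p ^ e := pow_pos (Fact.out : p.Prime).pos e
  induction g using MvPolynomial.induction_on' with
  | add g₁ g₂ h₁ h₂ =>
    simp only [mul_add, map_add, add_pow_char_pow, add_mul, Finset.sum_add_distrib]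
    rw [← h₁, ← h₂]
  | monomial m c =>
    classical
    have key (β : Fin n → Fin (p ^ e)) :
        (∀ i, (p ^ e - 1 - (β i : ℕ) + m i) % p ^ e = p ^ e - 1) ↔
          β = fun i => ⟨m i % p ^ e, Nat.mod_lt _ hq⟩ := by
      rw [funext_iff]
      refine forall_congr' fun i => ?_
      rw [Fin.ext_iff]
      have hβ := (β i).isLt
      have hm := Nat.mod_lt (m i) hq
      generalize (β i : ℕ) = b at *
      rw [Nat.add_mod, Nat.mod_eq_of_lt (show p ^ e - 1 - b < p ^ e by omega)]
      dsimp only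
      generalize m i % p ^ e = r at *
      generalize p ^ e = q at *
      rcases lt_or_ge (q - 1 - b + r) q with h | h
      · rw [Nat.mod_eq_of_lt h]; omega
      · rw [Nat.mod_eq_sub_mod h, Nat.mod_eq_of_lt (by omega)]; omega
    rw [Finset.sum_eq_single fun i => ⟨m i % p ^ e, Nat.mod_lt _ hq⟩]
    · rw [monomial_mul, polynomialTrace_monomial, if_pos]
      · rw [monomial_pow, monomial_mul, ← iterateFrobeniusEquiv_def, RingEquiv.apply_symm_apply]
        simp only [one_mul, mul_one]
        refine congrArg (fun a => monomial a c) ?_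
        ext i
        have h := Nat.mod_lt (m i) hq
        have h' := Nat.div_add_mod (m i) (p ^ e)
        have : (p ^ e - 1 - m i % p ^ e + m i) / p ^ e = m i / p ^ e := by
          rw [Nat.div_eq_iff hq]
          have := mul_comm (p ^ e) (m i / p ^ e)
          omega
        simp [this, h']
      · simpa using (key _).2 rfl
    · intro β _ hβ
      rw [monomial_mul, polynomialTrace_monomial, if_neg, zero_pow hq.ne', zero_mul]
      simpa using mt (key β).1 hβ
    · simp

end PolynomialTrace

section Fedder

variable {S R : Type*} [CommRing S] [CommRing R] {I 𝔪 : Ideal S} {f : S →+* R} {q : ℕ}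

theorem exists_mul_eq_of_mem_map [h𝔪 : 𝔪.IsPrime]
    (hsurj : ∀ δ, ∃ a, ∃ s ∉ 𝔪, δ * f s = f a) {J : Ideal S} {δ : R} (hδ : δ ∈ J.map f) :
    ∃ a ∈ J, ∃ s ∉ 𝔪, δ * f s = f a := by
  refine Submodule.span_induction ?_ ?_ ?_ ?_ hδ
  · rintro _ ⟨a, ha, rfl⟩
    exact ⟨a, ha, 1, h𝔪.one_notMem, by simp⟩
  · exact ⟨0, J.zero_mem, 1, h𝔪.one_notMem, by simp⟩
  · rintro x y _ _ ⟨a, ha, s, hs, h⟩ ⟨b, hb, t, ht, h'⟩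
    refine ⟨a * t + b * s, J.add_mem (J.mul_mem_right _ ha) (J.mul_mem_right _ hb), s * t,
      h𝔪.mul_notMem hs ht, ?_⟩
    simp only [map_mul, map_add]
    linear_combination f t * h + f s * h'
  · rintro c x _ ⟨a, ha, s, hs, h⟩
    obtain ⟨b, t, ht, h'⟩ := hsurj c
    refine ⟨b * a, J.mul_mem_left _ ha, t * s, h𝔪.mul_notMem ht hs, ?_⟩
    simp only [map_mul, smul_eq_mul]
    linear_combination x * f s * h' + f b * h

/-- A `1/q`-linear map of `S` preserving `I` extends to the localization of `S ⧸ I` at `𝔪`. -/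
theorem exists_localization_extension [h𝔪 : 𝔪.IsPrime]
    (hunit : ∀ s, IsUnit (f s) ↔ s ∉ 𝔪) (hker : ∀ a, f a = 0 ↔ ∃ s ∉ 𝔪, s * a ∈ I)
    (hsurj : ∀ δ, ∃ a, ∃ s ∉ 𝔪, δ * f s = f a) (hq : q ≠ 0)
    (φ : S →+ S) (hφ : ∀ a b, φ (a ^ q * b) = a * φ b) (hI : ∀ a ∈ I, φ a ∈ I) :
    ∃ ψ : R →+ R, (∀ a b, ψ (a ^ q * b) = a * ψ b) ∧ ∀ a, ψ (f a) = f (φ a) := by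
  have hzero {a : S} (ha : f a = 0) : f (φ a) = 0 := by
    obtain ⟨s, hs, h⟩ := (hker a).1 ha
    refine (hker _).2 ⟨s, hs, ?_⟩
    rw [← hφ, ← Nat.succ_pred_eq_of_ne_zero hq, pow_succ, mul_assoc]
    exact hI _ (I.mul_mem_left _ h)
  have hcongr {a b : S} (h : f a = f b) : f (φ a) = f (φ b) := by
    rw [← sub_eq_zero, ← map_sub, ← map_sub]
    exact hzero (by rw [map_sub, h, sub_self])
  have hpow (s : S) : s ^ q = s ^ (q - 1) * s := (pow_sub_one_mul hq s).symm
  choose num den hden hnum using hsurj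
  choose inv hinv using fun δ => ((hunit _).2 (hden δ)).exists_right_inv
  let ψ (δ : R) : R := f (φ (num δ * den δ ^ (q - 1))) * inv δ
  have hψ (δ : R) (a t : S) (h : δ * f t = f a) : ψ δ * f t = f (φ (a * t ^ (q - 1))) := by
    have h₁ : f (t ^ q * (num δ * den δ ^ (q - 1))) =
        f (den δ ^ q * (a * t ^ (q - 1))) := by
      simp only [hpow, map_mul, ← h, ← hnum]
      ring
    have h₂ := hcongr h₁
    simp only [hφ, map_mul] at h₂
    simp only [ψ]
    linear_combination inv δ * h₂ + f (φ (a * t ^ (q - 1))) * hinv δ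
  have hψ' (δ : R) (a t : S) (ht : t ∉ 𝔪) (c : R) (h : δ * f t = f a)
      (hc : f (φ (a * t ^ (q - 1))) = c * f t) : ψ δ = c :=
    ((hunit t).2 ht).mul_right_cancel ((hψ δ a t h).trans hc)
  refine ⟨AddMonoidHom.mk' ψ fun x y => ?_, fun a b => ?_, fun a => ?_⟩
  · have hx := hψ x (num x * den y) (den x * den y) (by
      simp only [map_mul]; linear_combination f (den y) * hnum x)
    have hy := hψ y (num y * den x) (den x * den y) (by
      simp only [map_mul]; linear_combination f (den x) * hnum y)
    refine hψ' _ (num x * den y + num y * den x) (den x * den y)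
      (h𝔪.mul_notMem (hden x) (hden y)) _ ?_ ?_
    · simp only [map_mul, map_add]
      linear_combination f (den y) * hnum x + f (den x) * hnum y
    · rw [add_mul (num x * den y), map_add, map_add, ← hx, ← hy, add_mul]
  · have hb := hψ b (num b) (den b) (hnum b)
    refine hψ' _ (num a ^ q * num b) (den a ^ q * den b)
      (h𝔪.mul_notMem (fun h => hden a (h𝔪.mem_of_pow_mem _ h)) (hden b)) _ ?_ ?_
    · simp only [map_mul, map_pow, ← hnum]
      ring
    · have : num a ^ q * num b * (den a ^ q * den b) ^ (q - 1) =
          (num a * den a ^ (q - 1)) ^ q * (num b * den b ^ (q - 1)) := by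
        rw [mul_pow, mul_pow, ← pow_mul, ← pow_mul, mul_comm (q - 1) q]
        ring
      rw [this, hφ, map_mul, ← hb]
      change _ = a * ψ b * _
      have : f (den a) ^ q = f (den a) ^ (q - 1) * f (den a) := by
        rw [← map_pow, hpow, map_mul, map_pow]
      simp only [map_mul, map_pow, this, ← hnum]
      ring
  · refine hψ' _ a 1 h𝔪.one_notMem _ (by simp) (by simp)

variable {ι : Type*} [Fintype ι] {x y : ι → S} {Φ : S →+ S}

theorem exists_splitting_of_not_le [h𝔪 : 𝔪.IsPrime]
    (hunit : ∀ s, IsUnit (f s) ↔ s ∉ 𝔪) (hker : ∀ a, f a = 0 ↔ ∃ s ∉ 𝔪, s * a ∈ I)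
    (hsurj : ∀ δ, ∃ a, ∃ s ∉ 𝔪, δ * f s = f a) (hq : q ≠ 0)
    (hΦ : ∀ a b, Φ (a ^ q * b) = a * Φ b) (hcoord : ∀ g, g = ∑ i, Φ (y i * g) ^ q * x i)
    {J : Ideal S} (h : ¬ (frobPow I q).colon I * J ≤ frobPow 𝔪 q) :
    ∃ δ ∈ J.map f, ∃ ψ : R →+ R, (∀ a b, ψ (a ^ q * b) = a * ψ b) ∧ ψ δ = 1 := by
  rw [Ideal.mul_le] at h
  push Not at h
  obtain ⟨u, hu, g, hg, hug⟩ := h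
  obtain ⟨i, hi⟩ : ∃ i, Φ (y i * (u * g)) ∉ 𝔪 := by
    contrapose! hug
    exact mem_frobPow_of_forall_coord_mem hcoord hug
  obtain ⟨ψ, hψ, hψf⟩ := exists_localization_extension hunit hker hsurj hq
    (Φ.comp (AddMonoidHom.mulLeft (y i * u)))
    (fun a b => by simp only [AddMonoidHom.comp_apply, AddMonoidHom.coe_mulLeft]; rw [← hΦ]; ring_nf)
    (fun a ha => map_mem_of_mem_frobPow Φ hΦ (by
      rw [AddMonoidHom.coe_mulLeft, mul_assoc]
      exact Ideal.mul_mem_left _ _ (Submodule.mem_colon.1 hu a ha)))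
  obtain ⟨v, hv⟩ := ((hunit _).2 hi).exists_left_inv
  refine ⟨f g, Ideal.mem_map_of_mem f hg, (AddMonoidHom.mulLeft v).comp ψ, fun a b => ?_, ?_⟩
  · simp only [AddMonoidHom.comp_apply, AddMonoidHom.coe_mulLeft, hψ]
    ring
  · simpa [hψf, mul_assoc] using hv

theorem not_le_of_exists_splitting [IsNoetherianRing S] [h𝔪 : 𝔪.IsPrime]
    (hunit : ∀ s, IsUnit (f s) ↔ s ∉ 𝔪) (hker : ∀ a, f a = 0 ↔ ∃ s ∉ 𝔪, s * a ∈ I)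
    (hsurj : ∀ δ, ∃ a, ∃ s ∉ 𝔪, δ * f s = f a) (hq : q ≠ 0)
    (hΦ : ∀ a b, Φ (a ^ q * b) = a * Φ b) (hcoord : ∀ g, g = ∑ i, Φ (y i * g) ^ q * x i)
    {J : Ideal S}
    (h : ∃ δ ∈ J.map f, ∃ ψ : R →+ R, (∀ a b, ψ (a ^ q * b) = a * ψ b) ∧ ψ δ = 1) :
    ¬ (frobPow I q).colon I * J ≤ frobPow 𝔪 q := by
  classical
  obtain ⟨δ, hδ, ψ, hψ, hψδ⟩ := h
  obtain ⟨g, hg, s, hs, hgs⟩ := exists_mul_eq_of_mem_map hsurj hδ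
  obtain ⟨z, hz, hzI⟩ : ∃ z ∉ 𝔪, ∀ a, f a = 0 → z * a ∈ I := by
    obtain ⟨T, hT⟩ := (inferInstance : IsNoetherianRing S).noetherian (RingHom.ker f)
    have hT' (a : T) : f a = 0 := by
      have : (a : S) ∈ RingHom.ker f := hT ▸ Submodule.subset_span a.2
      exact this
    choose z hz hzI using fun a : T => (hker a).1 (hT' a)
    refine ⟨∏ a, z a, fun h => ?_, fun a ha => ?_⟩
    · obtain ⟨a, -, ha⟩ := h𝔪.prod_mem_iff.1 h
      exact hz a ha
    · have ha' : a ∈ Submodule.span S (T : Set S) := hT ▸ ha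
      refine Submodule.span_induction ?_ (by simp) ?_ ?_ ha'
      · intro b hb
        obtain ⟨d, hd⟩ := Finset.dvd_prod_of_mem z (Finset.mem_univ (⟨b, hb⟩ : T))
        rw [hd, mul_right_comm]
        exact I.mul_mem_right _ (hzI _)
      · intro b c _ _ hb hc
        rw [mul_add]
        exact I.add_mem hb hc
      · intro b c _ hc
        rw [smul_eq_mul, mul_left_comm]
        exact I.mul_mem_left _ hc
  choose num den hden hnum using hsurj
  let w := ∏ i, den (ψ (f (x i)))
  have hw : w ∉ 𝔪 := fun h => by
    obtain ⟨a, -, ha⟩ := h𝔪.prod_mem_iff.1 h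
    exact hden _ ha
  have hc (i : ι) : ∃ c, f c = f w * ψ (f (x i)) := by
    obtain ⟨d, hd⟩ := Finset.dvd_prod_of_mem (fun i => den (ψ (f (x i)))) (Finset.mem_univ i)
    refine ⟨num (ψ (f (x i))) * d, ?_⟩
    simp only [w, hd, map_mul, ← hnum]
    ring
  choose c hc using hc
  let u := ∑ i, (z * c i) ^ q * y i
  have hu (b : S) : Φ (u * b) = z * ∑ i, c i * Φ (y i * b) := by
    simp only [u, Finset.sum_mul, map_sum, mul_assoc, hΦ, Finset.mul_sum]
  have hfu (b : S) : f (∑ i, c i * Φ (y i * b)) = f w * ψ (f b) := by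
    conv_rhs => rw [hcoord b]
    simp only [map_sum, map_mul, map_pow, hψ, Finset.mul_sum, hc]
    exact Finset.sum_congr rfl fun i _ => by ring
  have huI : u ∈ (frobPow I q).colon I := Submodule.mem_colon.2 fun a ha =>
    mem_frobPow_of_forall_coord_mem hcoord fun i => by
      rw [smul_eq_mul, mul_left_comm, hu]
      refine hzI _ ?_
      rw [hfu, (hker (y i * a)).2 ⟨1, h𝔪.one_notMem, by simpa using I.mul_mem_left _ ha⟩]
      simp
  intro hle
  have hmem := map_mem_of_mem_frobPow Φ hΦ
    (hle (Ideal.mul_mem_mul huI (J.mul_mem_left (s ^ (q - 1)) hg)))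
  refine (hunit _).1 ?_ hmem
  have hs' : f (s ^ (q - 1) * g) = f s ^ q * δ := by
    rw [map_mul, ← hgs, map_pow, ← pow_sub_one_mul hq (f s)]
    ring
  rw [hu, map_mul, hfu, hs', hψ, hψδ, mul_one]
  exact ((hunit z).2 hz).mul (((hunit w).2 hw).mul ((hunit s).2 hs))

end Fedder

section QuotientLocalization

variable {S : Type*} [CommRing S] {I 𝔪 : Ideal S}

theorem mk_mem_map_mk_iff (hI : I ≤ 𝔪) (s : S) :
    Ideal.Quotient.mk I s ∈ 𝔪.map (Ideal.Quotient.mk I) ↔ s ∈ 𝔪 := by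
  rw [← Ideal.mem_comap, Ideal.comap_map_of_surjective' _ Ideal.Quotient.mk_surjective,
    Ideal.mk_ker, sup_eq_left.2 hI]

variable [hP : (𝔪.map (Ideal.Quotient.mk I)).IsPrime]

variable (I 𝔪) in
/-- The canonical map from `S` to the localization of `S ⧸ I` at `𝔪`. -/
noncomputable abbrev toQuotientLocalization :
    S →+* Localization.AtPrime (𝔪.map (Ideal.Quotient.mk I)) :=
  (algebraMap (S ⧸ I) (Localization.AtPrime (𝔪.map (Ideal.Quotient.mk I)))).comp
    (Ideal.Quotient.mk I)

theorem isUnit_toQuotientLocalization_iff (hI : I ≤ 𝔪) (s : S) :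
    IsUnit (toQuotientLocalization I 𝔪 s) ↔ s ∉ 𝔪 := by
  rw [RingHom.comp_apply, IsLocalization.AtPrime.isUnit_to_map_iff _ (𝔪.map (Ideal.Quotient.mk I)),
    Ideal.mem_primeCompl_iff, mk_mem_map_mk_iff hI]

theorem toQuotientLocalization_eq_zero_iff (hI : I ≤ 𝔪) (a : S) :
    toQuotientLocalization I 𝔪 a = 0 ↔ ∃ s ∉ 𝔪, s * a ∈ I := by
  rw [RingHom.comp_apply, IsLocalization.map_eq_zero_iff (𝔪.map (Ideal.Quotient.mk I)).primeCompl]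
  constructor
  · rintro ⟨⟨m, hm⟩, h⟩
    obtain ⟨s, rfl⟩ := Ideal.Quotient.mk_surjective m
    exact ⟨s, fun hs => hm ((mk_mem_map_mk_iff hI s).2 hs),
      by simpa [← map_mul, Ideal.Quotient.eq_zero_iff_mem] using h⟩
  · rintro ⟨s, hs, h⟩
    exact ⟨⟨Ideal.Quotient.mk I s, fun h' => hs ((mk_mem_map_mk_iff hI s).1 h')⟩,
      by simpa [← map_mul, Ideal.Quotient.eq_zero_iff_mem] using h⟩

theorem exists_mul_toQuotientLocalization_eq (hI : I ≤ 𝔪)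
    (δ : Localization.AtPrime (𝔪.map (Ideal.Quotient.mk I))) :
    ∃ a, ∃ s ∉ 𝔪, δ * toQuotientLocalization I 𝔪 s = toQuotientLocalization I 𝔪 a := by
  obtain ⟨⟨a, ⟨m, hm⟩⟩, h⟩ := IsLocalization.surj (𝔪.map (Ideal.Quotient.mk I)).primeCompl δ
  obtain ⟨s, rfl⟩ := Ideal.Quotient.mk_surjective m
  obtain ⟨b, rfl⟩ := Ideal.Quotient.mk_surjective a
  exact ⟨b, s, fun hs => hm ((mk_mem_map_mk_iff hI s).2 hs), h⟩

end QuotientLocalization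

set_option synthInstance.maxHeartbeats 1000000 in
/-- Fedder-type criterion of Lemma 1.4(2). With `S = K[x_1, …, x_n]`,
`I ⊆ 𝔪` ideals with `𝔪` maximal, ideals `𝔞_i` not contained in any minimal prime of `I`,
reals `t_i ≥ 0`, and `R` the localization of `S/I` at `𝔪/I`: sharp F-purity at `𝔪`
(condition (a), expressed via a `p^{-e}`-linear map `ψ : R → R` sending some `δ` in the
image of `∏ 𝔞_i^{⌈t_i(p^e−1)⌉}` to `1`) is equivalent to the Fedder-type
non-containment (b). -/
theorem stmt_2 (p : ℕ) [Fact p.Prime] (K : Type*) [Field K] [CharP K p] [PerfectRing K p]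
    (n : ℕ) (I 𝔪 : Ideal (MvPolynomial (Fin n) K)) (hm : 𝔪.IsMaximal) (hIm : I ≤ 𝔪)
    (r : ℕ) (𝔞 : Fin r → Ideal (MvPolynomial (Fin n) K))
    (h𝔞 : ∀ i, ∀ P ∈ I.minimalPrimes, ¬ 𝔞 i ≤ P)
    (t : Fin r → ℝ) (ht : ∀ i, 0 ≤ t i)
    [hP : (Ideal.map (Ideal.Quotient.mk I) 𝔪).IsPrime] :
    (∃ e : ℕ, 1 ≤ e ∧
      ∃ δ ∈ Ideal.map
          ((algebraMap (MvPolynomial (Fin n) K ⧸ I)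
              (Localization.AtPrime (Ideal.map (Ideal.Quotient.mk I) 𝔪))).comp
            (Ideal.Quotient.mk I))
          (∏ i, 𝔞 i ^ ⌈t i * ((p : ℝ) ^ e - 1)⌉₊),
        ∃ ψ : Localization.AtPrime (Ideal.map (Ideal.Quotient.mk I) 𝔪) →+
              Localization.AtPrime (Ideal.map (Ideal.Quotient.mk I) 𝔪),
          (∀ a b, ψ (a ^ p ^ e * b) = a * ψ b) ∧ ψ δ = 1) ↔
    (∃ e : ℕ, 1 ≤ e ∧
      ¬((frobPow I (p ^ e)).colon I * ∏ i, 𝔞 i ^ ⌈t i * ((p : ℝ) ^ e - 1)⌉₊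
          ≤ frobPow 𝔪 (p ^ e))) := by
  have hq (e : ℕ) : p ^ e ≠ 0 := pow_ne_zero e (Fact.out : p.Prime).ne_zero
  have hprime := hm.isPrime
  refine exists_congr fun e => and_congr_right fun _ => ⟨fun h => ?_, fun h => ?_⟩
  · exact not_le_of_exists_splitting (isUnit_toQuotientLocalization_iff hIm)
      (toQuotientLocalization_eq_zero_iff hIm) (exists_mul_toQuotientLocalization_eq hIm) (hq e)
      (polynomialTrace_pow_mul e) (eq_sum_polynomialTrace e) h
  · exact exists_splitting_of_not_le (isUnit_toQuotientLocalization_iff hIm)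
      (toQuotientLocalization_eq_zero_iff hIm) (exists_mul_toQuotientLocalization_eq hIm) (hq e)
      (polynomialTrace_pow_mul e) (eq_sum_polynomialTrace e) h
end

section
/- Let K be a perfect field of characteristic p > 0 and S = K[x_1, …, x_n]. Let f_1, …, f_c ∈ S be a regular sequence and I = (f_1, …, f_c). Then for every integer e ≥ 1, setting q = p^e, one has (I^{[q]} :_S I) = (f_1 ⋯ f_c)^{q−1}·S + I^{[q]}. -/
/-- Multiplication by `a` is injective modulo the ideal `A`. -/
def RegularMod {R : Type*} [CommRing R] (A : Ideal R) (a : R) : Prop :=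
  ∀ x, a * x ∈ A → x ∈ A

/-- The list is a weakly regular sequence modulo the ideal `A`. -/
def WeaklyRegularMod {R : Type*} [CommRing R] : Ideal R → List R → Prop
  | _, [] => True
  | A, a :: l => RegularMod A a ∧ WeaklyRegularMod (Ideal.span {a} ⊔ A) l

section

variable {R : Type*} [CommRing R] {A : Ideal R} {a b : R}

theorem RegularMod.pow (h : RegularMod A a) (k : ℕ) : RegularMod A (a ^ k) := by
  induction k with
  | zero => intro x hx; simpa using hx
  | succ k ih =>
    intro x hx
    rw [pow_succ, mul_assoc] at hx
    exact h _ (ih _ hx)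

/-- Cancelling `a ^ k` in `a ^ k * x ∈ (a ^ (k + j)) + A`. -/
theorem RegularMod.mem_of_pow_mul_mem (h : RegularMod A a) {k j : ℕ} {x : R}
    (hx : a ^ k * x ∈ Ideal.span {a ^ (k + j)} ⊔ A) : x ∈ Ideal.span {a ^ j} ⊔ A := by
  obtain ⟨z, s, hs, e⟩ := Ideal.mem_span_singleton_sup.1 hx
  refine Ideal.mem_span_singleton_sup.2 ⟨z, x - z * a ^ j, h.pow k _ ?_, by ring⟩
  convert hs using 1
  linear_combination -e

theorem RegularMod.swap (ha : RegularMod A a) (hb : RegularMod (Ideal.span {a} ⊔ A) b) :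
    RegularMod (Ideal.span {b} ⊔ A) a := by
  intro x hx
  obtain ⟨y, s, hs, e⟩ := Ideal.mem_span_singleton_sup.1 hx
  obtain ⟨z, t, ht, e'⟩ := Ideal.mem_span_singleton_sup.1
    (hb y (Ideal.mem_span_singleton_sup.2 ⟨x, -s, A.neg_mem hs, by linear_combination -e⟩))
  refine Ideal.mem_span_singleton_sup.2 ⟨z, x - z * b, ha _ ?_, by ring⟩
  convert A.add_mem hs (A.mul_mem_left b ht) using 1
  linear_combination -e - b * e'

theorem RegularMod.sup_span_pow (ha : RegularMod A a)
    (hb : RegularMod (Ideal.span {a} ⊔ A) b) (k : ℕ) :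
    RegularMod (Ideal.span {a ^ k} ⊔ A) b := by
  induction k with
  | zero => intro x _; simp
  | succ k ih =>
    intro x hx
    have hle : Ideal.span {a ^ (k + 1)} ⊔ A ≤ Ideal.span {a ^ k} ⊔ A :=
      sup_le_sup_right (Ideal.span_singleton_le_span_singleton.2 (pow_dvd_pow a k.le_succ)) A
    obtain ⟨y, s, hs, rfl⟩ := Ideal.mem_span_singleton_sup.1 (ih x (hle hx))
    have hy : a ^ k * (b * y) ∈ Ideal.span {a ^ (k + 1)} ⊔ A := by
      convert sub_mem hx (Ideal.mul_mem_left _ b (Ideal.mem_sup_right hs)) using 1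
      ring
    have hy' := ha.mem_of_pow_mul_mem hy
    rw [pow_one] at hy'
    obtain ⟨w, t, ht, rfl⟩ := Ideal.mem_span_singleton_sup.1 (hb y hy')
    exact Ideal.mem_span_singleton_sup.2
      ⟨w, t * a ^ k + s, A.add_mem (A.mul_mem_right _ ht) hs, by ring⟩

theorem WeaklyRegularMod.sup_span_pow {l : List R} (k : ℕ)
    (h : WeaklyRegularMod A (a :: l)) : WeaklyRegularMod (Ideal.span {a ^ k} ⊔ A) l := by
  induction l generalizing A with
  | nil => trivial
  | cons b l ih =>
    obtain ⟨ha, hb, hl⟩ := h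
    refine ⟨ha.sup_span_pow hb k, ?_⟩
    rw [sup_left_comm] at hl ⊢
    exact ih ⟨ha.swap hb, hl⟩

theorem WeaklyRegularMod.regularMod_ofList {l : List R}
    (h : WeaklyRegularMod A (a :: l)) : RegularMod (Ideal.ofList l ⊔ A) a := by
  induction l generalizing A with
  | nil => simpa using h.1
  | cons b l ih =>
    obtain ⟨ha, hb, hl⟩ := h
    rw [sup_left_comm] at hl
    rw [Ideal.ofList_cons, sup_comm (Ideal.span {b}), sup_assoc]
    exact ih ⟨ha.swap hb, hl⟩

theorem ofList_map_pow_cons_sup (l : List R) (k : ℕ) :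
    Ideal.ofList ((a :: l).map (· ^ k)) ⊔ A =
      Ideal.ofList (l.map (· ^ k)) ⊔ (Ideal.span {a ^ k} ⊔ A) := by
  rw [List.map_cons, Ideal.ofList_cons, sup_comm (Ideal.span {a ^ k}), sup_assoc]

theorem WeaklyRegularMod.mem_of_prod_pow_mul_mem {l : List R} {k : ℕ} {m : R}
    (h : WeaklyRegularMod A l)
    (hm : l.prod ^ k * m ∈ Ideal.ofList (l.map (· ^ (k + 1))) ⊔ A) :
    m ∈ Ideal.ofList l ⊔ A := by
  induction l generalizing A m with
  | nil => simpa using hm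
  | cons a l ih =>
    rw [ofList_map_pow_cons_sup, List.prod_cons, mul_pow, mul_comm (a ^ k), mul_assoc] at hm
    have := ih (h.sup_span_pow (k + 1)) hm
    rw [sup_left_comm] at this
    simpa [sup_assoc] using h.regularMod_ofList.mem_of_pow_mul_mem this

theorem prod_pow_mul_mem_ofList_map_pow (l : List R) (k : ℕ) {x : R}
    (hx : x ∈ Ideal.ofList l) : l.prod ^ k * x ∈ Ideal.ofList (l.map (· ^ (k + 1))) := by
  refine Submodule.span_induction (fun b hb => ?_) (by simp)
    (fun x y _ _ hx hy => by rw [mul_add]; exact add_mem hx hy)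
    (fun r x _ hx => by rw [smul_eq_mul, mul_left_comm]; exact Ideal.mul_mem_left _ r hx) hx
  obtain ⟨u, hu⟩ := List.dvd_prod hb
  have hbk : b ^ (k + 1) ∈ Ideal.ofList (l.map (· ^ (k + 1))) :=
    Ideal.subset_span (List.mem_map.2 ⟨b, hb, rfl⟩)
  convert Ideal.mul_mem_left _ (u ^ k) hbk using 1
  rw [hu]
  ring

theorem WeaklyRegularMod.mem_of_forall_mul_mem {l : List R} {k : ℕ} {m : R}
    (h : WeaklyRegularMod A l)
    (hm : ∀ b ∈ l, b * m ∈ Ideal.ofList (l.map (· ^ (k + 1))) ⊔ A) :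
    m ∈ Ideal.span {l.prod ^ k} ⊔ (Ideal.ofList (l.map (· ^ (k + 1))) ⊔ A) := by
  induction l generalizing A m with
  | nil => simp
  | cons a l ih =>
    rw [ofList_map_pow_cons_sup] at hm ⊢
    have hA := h.sup_span_pow (k + 1)
    obtain ⟨m', s, hs, rfl⟩ := Ideal.mem_span_singleton_sup.1
      (ih hA fun b hb => hm b (List.mem_cons_of_mem a hb))
    have h1 : l.prod ^ k * (a * m') ∈
        Ideal.ofList (l.map (· ^ (k + 1))) ⊔ (Ideal.span {a ^ (k + 1)} ⊔ A) := by
      convert sub_mem (hm a List.mem_cons_self) (Ideal.mul_mem_left _ a hs) using 1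
      ring
    have h2 := hA.mem_of_prod_pow_mul_mem h1
    rw [sup_left_comm, ← pow_one a, ← pow_mul, one_mul, add_comm k 1] at h2
    obtain ⟨z, t, ht, rfl⟩ := Ideal.mem_span_singleton_sup.1
      (h.regularMod_ofList.mem_of_pow_mul_mem h2)
    obtain ⟨u, hu, v, hv, rfl⟩ := Submodule.mem_sup.1 ht
    refine Ideal.mem_span_singleton_sup.2
      ⟨z, l.prod ^ k * u + l.prod ^ k * v + s, add_mem (add_mem ?_ ?_) hs, ?_⟩
    · exact Ideal.mem_sup_left (prod_pow_mul_mem_ofList_map_pow l k hu)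
    · exact Ideal.mem_sup_right (Ideal.mem_sup_right (A.mul_mem_left _ hv))
    · rw [List.prod_cons]
      ring

theorem WeaklyRegularMod.of_forall_take {l : List R}
    (h : ∀ (i : ℕ) (hi : i < l.length), RegularMod (Ideal.ofList (l.take i) ⊔ A) l[i]) :
    WeaklyRegularMod A l := by
  induction l generalizing A with
  | nil => trivial
  | cons a l ih =>
    refine ⟨?_, ih fun i hi => ?_⟩
    · have := h 0 (Nat.succ_pos _)
      rwa [List.take_zero, Ideal.ofList_nil, bot_sup_eq] at this
    · have := h (i + 1) (by simpa using hi)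
      rwa [List.take_succ_cons, Ideal.ofList_cons, sup_comm (Ideal.span {a}),
        sup_assoc] at this

theorem RingTheory.Sequence.IsWeaklyRegular.weaklyRegularMod_bot {l : List R}
    (h : RingTheory.Sequence.IsWeaklyRegular R l) : WeaklyRegularMod ⊥ l := by
  refine .of_forall_take fun i hi x hx => ?_
  have hreg := h.regular_mod_prev i hi
  rw [sup_bot_eq] at hx ⊢
  have hmem (y : R) : y ∈ Ideal.ofList (l.take i) ↔
      y ∈ (Ideal.ofList (l.take i) • ⊤ : Submodule R R) := by simp
  rw [hmem, ← Submodule.Quotient.mk_eq_zero] at hx ⊢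
  exact hreg (hx.trans (smul_zero l[i]).symm)

/-- For a weakly regular sequence `l`, the colon of the ideal of `(k + 1)`-st powers of the
members by the ideal of the members is generated by these powers and by `l.prod ^ k`. -/
theorem RingTheory.Sequence.IsWeaklyRegular.colon_ofList_map_pow {l : List R}
    (h : RingTheory.Sequence.IsWeaklyRegular R l) (k : ℕ) :
    (Ideal.ofList (l.map (· ^ (k + 1)))).colon (Ideal.ofList l : Set R) =
      Ideal.span {l.prod ^ k} ⊔ Ideal.ofList (l.map (· ^ (k + 1))) := by
  refine le_antisymm (fun m hm => ?_) (sup_le ?_ ?_)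
  · rw [Submodule.mem_colon] at hm
    simpa using h.weaklyRegularMod_bot.mem_of_forall_mul_mem (k := k) (m := m)
      fun b hb => by simpa [mul_comm] using hm b (Ideal.subset_span hb)
  · rw [Ideal.span_singleton_le_iff_mem, Submodule.mem_colon]
    exact fun x hx => prod_pow_mul_mem_ofList_map_pow l k hx
  · exact fun m hm => Submodule.mem_colon.2 fun x _ => Ideal.mul_mem_right x _ hm

theorem frobPow_span (p : ℕ) [ExpChar R p] (e : ℕ) (s : Set R) :
    frobPow (Ideal.span s) (p ^ e) = Ideal.span ((· ^ p ^ e) '' s) := by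
  have h := Ideal.map_span (iterateFrobenius R p e) s
  rwa [Ideal.map, funext (iterateFrobenius_def (R := R) p e)] at h

end

/-- complete-intersection case of the Claim in the proof of Theorem 3.2.
For a regular sequence `f_1, …, f_c` in `S = K[x_1, …, x_n]` over a perfect field of
characteristic `p > 0`, with `I = (f_1, …, f_c)` and `q = p^e` (`e ≥ 1`), one has
`(I^{[q]} : I) = (f_1 ⋯ f_c)^{q−1}·S + I^{[q]}`. -/
theorem stmt_3 (p : ℕ) [Fact p.Prime] (K : Type*) [Field K] [CharP K p] [PerfectRing K p]
    (n c : ℕ) (f : Fin c → MvPolynomial (Fin n) K)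
    (hf : RingTheory.Sequence.IsRegular (MvPolynomial (Fin n) K) (List.ofFn f))
    (e : ℕ) (he : 1 ≤ e) :
    (frobPow (Ideal.span (Set.range f)) (p ^ e)).colon (Ideal.span (Set.range f)) =
      Ideal.span {(∏ i, f i) ^ (p ^ e - 1)} +
        frobPow (Ideal.span (Set.range f)) (p ^ e) := by
  have hI : Ideal.span (Set.range f) = Ideal.ofList (List.ofFn f) := by
    simp only [Ideal.ofList, List.mem_ofFn, Set.range]
  have hF : frobPow (Ideal.span (Set.range f)) (p ^ e) =
      Ideal.ofList ((List.ofFn f).map (· ^ (p ^ e - 1 + 1))) := by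
    rw [frobPow_span, Nat.sub_add_cancel (Nat.one_le_pow _ _ (Fact.out : p.Prime).pos)]
    congr 1
    ext x
    simp
  rw [hF, hI, hf.toIsWeaklyRegular.colon_ofList_map_pow, List.prod_ofFn, Ideal.add_eq_sup]
end

section
/- Let p be a prime, let K be a field of characteristic p, let s ≥ 1 and n ≥ 1 be integers, let m_1, …, m_s ≥ 1 be integers, and for each i = 1, …, s and j = 1, …, m_i let a_{ij} ∈ ℤ_{≥0}^n \ {0} be a nonzero exponent vector and u_{ij} ∈ K, where the family (u_{ij})_{i,j} is algebraically independent over the prime field 𝔽_p. Set f_i = Σ_{j=1}^{m_i} u_{ij} x_1^{a_{ij}(1)} ⋯ x_n^{a_{ij}(n)} ∈ K[x_1, …, x_n]. Let κ_{ij} ∈ ℤ_{≥0} be nonnegative integers such that (i) Σ_{j=1}^{m_i} κ_{ij} ≤ p − 1 for each i = 1, …, s, and (ii) Σ_{i=1}^{s} Σ_{j=1}^{m_i} κ_{ij} · a_{ij}(k) ≤ p − 1 for each k = 1, …, n. Then the product ∏_{i=1}^{s} f_i^{Σ_{j=1}^{m_i} κ_{ij}} does not lie in the ideal (x_1^p,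 …, x_n^p) of K[x_1, …, x_n]. -/
open MvPolynomial

/-- A multinomial coefficient whose total is less than a prime `p` is nonzero mod `p`. -/
theorem natCast_multinomial_ne_zero {ι R : Type*} [CommRing R] {p : ℕ} [CharP R p]
    (hp : p.Prime) (t : Finset ι) (f : ι → ℕ) (hf : ∑ i ∈ t, f i < p) :
    (Nat.multinomial t f : R) ≠ 0 := by
  rw [Ne, CharP.cast_eq_zero_iff R p]
  intro h
  have hdvd : p ∣ (∑ i ∈ t, f i).factorial := by
    rw [← Nat.multinomial_spec]
    exact h.mul_left _
  exact hf.not_ge ((hp.dvd_factorial).1 hdvd)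

/-- The coefficients of a product of powers of sums of disjoint sets of variables. -/
theorem coeff_prod_sum_X_pow {ι R : Type*} [Fintype ι] [DecidableEq ι] [CommSemiring R]
    {β : ι → Type*} [∀ i, Fintype (β i)] [∀ i, DecidableEq (β i)]
    (κ : (i : ι) → β i → ℕ) :
    coeff (Finsupp.equivFunOnFinite.symm fun x : Σ i, β i => κ x.1 x.2)
      (∏ i, (∑ j, X (⟨i, j⟩ : Σ i, β i)) ^ (∑ j, κ i j) : MvPolynomial (Σ i, β i) R) =
      ∏ i, (Nat.multinomial Finset.univ (κ i) : R) := by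
  have key : ∀ k : (i : ι) → β i → ℕ,
      (∏ i, ((Nat.multinomial Finset.univ (k i) : MvPolynomial (Σ i, β i) R) *
        ∏ j, X (⟨i, j⟩ : Σ i, β i) ^ k i j)) =
      monomial (Finsupp.equivFunOnFinite.symm fun x : Σ i, β i => k x.1 x.2)
        (∏ i, (Nat.multinomial Finset.univ (k i) : R)) := by
    intro k
    rw [monomial_eq, Finsupp.prod_fintype _ _ (by simp), Finset.prod_mul_distrib,
      Fintype.prod_sigma]
    simp
  simp_rw [Finset.sum_pow_eq_sum_piAntidiag]
  rw [Finset.prod_univ_sum, coeff_sum, Finset.sum_eq_single κ]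
  · rw [key, coeff_monomial, if_pos rfl]
  · intro k _ hk
    rw [key, coeff_monomial, if_neg]
    intro h
    apply hk
    funext i j
    simpa using DFunLike.congr_fun h (⟨i, j⟩ : Σ i, β i)
  · intro h
    exact absurd (by simp) h

/-- Under the substitution `X i ↦ X i * x ^ a i`, the coefficient of `X ^ d` is found as the
coefficient of `X ^ d` in the coefficient of `x ^ (∑ i, d i • a i)`. -/
theorem coeff_coeff_aeval_C_X_mul_monomial {σ τ R : Type*} [CommSemiring R]
    (a : σ → τ →₀ ℕ) (d : σ →₀ ℕ) (P : MvPolynomial σ R) :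
    coeff d (coeff (d.sum fun i k => k • a i)
      (aeval (fun i => (C (X i) * monomial (a i) 1 : MvPolynomial τ (MvPolynomial σ R))) P)) =
      coeff d P := by
  classical
  induction P using MvPolynomial.induction_on' with
  | add P Q hP hQ => simp only [map_add, coeff_add, hP, hQ]
  | monomial e c =>
    have h : aeval (fun i => (C (X i) * monomial (a i) 1 :
        MvPolynomial τ (MvPolynomial σ R))) (monomial e c) =
        monomial (e.sum fun i k => k • a i) (monomial e c) := by
      rw [aeval_monomial, monomial_finsupp_sum_index, monomial_eq (a := c)]
      simp [-prod_X_pow_eq_monomial, Finsupp.prod, mul_pow, Finset.prod_mul_distrib,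
        mul_assoc, monomial_pow,
        IsScalarTower.algebraMap_apply R (MvPolynomial σ R)
          (MvPolynomial τ (MvPolynomial σ R)), algebraMap_eq]
    rw [h, coeff_monomial]
    by_cases hed : e = d
    · simp [hed]
    · rw [coeff_monomial, if_neg hed]
      split_ifs <;> simp [coeff_monomial, hed]

/-- A polynomial with a nonzero coefficient whose exponents are all less than `p` does not lie
in the ideal generated by the `p`-th powers of the variables. -/
theorem notMem_span_range_X_pow {τ R : Type*} [CommSemiring R] {p : ℕ}
    {P : MvPolynomial τ R} {e : τ →₀ ℕ} (he : ∀ k, e k < p) (hP : coeff e P ≠ 0) :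
    P ∉ Ideal.span (Set.range fun k : τ => (X k : MvPolynomial τ R) ^ p) := by
  have h : (Set.range fun k : τ => (X k : MvPolynomial τ R) ^ p) =
      (fun d => monomial d (1 : R)) '' Set.range fun k : τ => Finsupp.single k p := by
    rw [← Set.range_comp]
    simp only [Function.comp_def, X_pow_eq_monomial]
  rw [h, mem_ideal_span_monomial_image]
  intro H
  obtain ⟨_, ⟨k, rfl⟩, hk⟩ := H e (mem_support_iff.2 hP)
  have := hk k
  rw [Finsupp.single_eq_same] at this
  exact (he k).not_ge this

/-- key characteristic-`p` step in the proof of Theorem 4.1.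
If the coefficients `u_{ij}` of the polynomials
`f_i = Σ_j u_{ij} x^{a_{ij}}` are algebraically independent over `𝔽_p`, the exponent
vectors `a_{ij}` are nonzero, and the nonnegative integers `κ_{ij}` satisfy
`Σ_j κ_{ij} ≤ p − 1` for each `i` and `Σ_{i,j} κ_{ij} a_{ij}(k) ≤ p − 1` for each `k`,
then `∏_i f_i^{Σ_j κ_{ij}} ∉ (x_1^p, …, x_n^p)`. -/
theorem stmt_4 (p : ℕ) (hp : p.Prime) (K : Type*) [Field K] [CharP K p]
    [Algebra (ZMod p) K] (s n : ℕ) (hs : 1 ≤ s) (hn : 1 ≤ n)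
    (m : Fin s → ℕ) (hm : ∀ i, 1 ≤ m i)
    (a : (i : Fin s) → Fin (m i) → Fin n → ℕ) (ha : ∀ i j, a i j ≠ 0)
    (u : (i : Fin s) → Fin (m i) → K)
    (hu : AlgebraicIndependent (ZMod p)
      (fun x : Σ i : Fin s, Fin (m i) => u x.1 x.2))
    (κ : (i : Fin s) → Fin (m i) → ℕ)
    (hκ1 : ∀ i, ∑ j, κ i j ≤ p - 1)
    (hκ2 : ∀ k : Fin n, ∑ i, ∑ j, κ i j * a i j k ≤ p - 1) :
    (∏ i, (∑ j, C (u i j) * ∏ k, X k ^ a i j k) ^ (∑ j, κ i j)) ∉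
      Ideal.span (Set.range fun k : Fin n => (X k : MvPolynomial (Fin n) K) ^ p) := by
  have : Fact p.Prime := ⟨hp⟩
  set A : (Σ i, Fin (m i)) → Fin n →₀ ℕ :=
    fun x => Finsupp.equivFunOnFinite.symm (a x.1 x.2) with hA
  set d : (Σ i, Fin (m i)) →₀ ℕ :=
    Finsupp.equivFunOnFinite.symm fun x => κ x.1 x.2 with hd
  set P : MvPolynomial (Σ i, Fin (m i)) (ZMod p) :=
    ∏ i, (∑ j, X ⟨i, j⟩) ^ (∑ j, κ i j) with hPdef
  have hPd : coeff d P ≠ 0 := by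
    rw [hd, hPdef, coeff_prod_sum_X_pow, Finset.prod_ne_zero_iff]
    intro i _
    exact natCast_multinomial_ne_zero hp _ _
      ((hκ1 i).trans_lt (Nat.sub_lt hp.pos one_pos))
  set Q := aeval (fun x => (C (X x) * monomial (A x) 1 :
    MvPolynomial (Fin n) (MvPolynomial (Σ i, Fin (m i)) (ZMod p)))) P with hQdef
  set θ := coeff (d.sum fun x k => k • A x) Q with hθ
  have hθ0 : θ ≠ 0 := by
    intro h
    apply hPd
    rw [← coeff_coeff_aeval_C_X_mul_monomial A d P, ← hQdef, ← hθ, h, coeff_zero]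
  have hprod : (∏ i, (∑ j, C (u i j) * ∏ k, X k ^ a i j k) ^ (∑ j, κ i j)) =
      map (aeval fun x : Σ i, Fin (m i) => u x.1 x.2 :
        MvPolynomial (Σ i, Fin (m i)) (ZMod p) →ₐ[ZMod p] K).toRingHom Q := by
    rw [hQdef, hPdef]
    simp [map_prod, map_sum, map_pow, hA, monomial_eq, Finsupp.prod_fintype]
  rw [hprod]
  refine notMem_span_range_X_pow (e := d.sum fun x k => k • A x) (fun k => ?_) ?_
  · refine lt_of_eq_of_lt ?_ ((hκ2 k).trans_lt (Nat.sub_lt hp.pos one_pos))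
    rw [Finsupp.sum_fintype _ _ (by simp), Fintype.sum_sigma]
    simp [hA, hd, Finsupp.finsetSum_apply]
  · rw [coeff_map]
    intro h
    exact hθ0 (hu.eq_zero_of_aeval_eq_zero _ h)
end

section
/- Let K be a perfect field of characteristic p > 0, let S = K[x_1, …, x_n], and let h ∈ S satisfy h ∉ (x_1^p, …, x_n^p). Then for every integer e ≥ 1 one has h^{1 + p + p^2 + ⋯ + p^{e−1}} ∉ (x_1^{p^e}, …, x_n^{p^e}). -/
open MvPolynomial

namespace MvPolynomial

variable {σ R : Type*}

/-- A polynomial lies outside `(X_i ^ N)_i` iff it has a monomial all of whose exponents are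
less than `N`. -/
theorem notMem_span_range_X_pow_iff [CommSemiring R] {N : ℕ} {f : MvPolynomial σ R} :
    f ∉ Ideal.span (Set.range fun i : σ => (X i : MvPolynomial σ R) ^ N) ↔
      ∃ m ∈ f.support, ∀ i, m i < N := by
  have hset : (Set.range fun i : σ => (X i : MvPolynomial σ R) ^ N) =
      (fun s => monomial s (1 : R)) '' Set.range fun i : σ => Finsupp.single i N := by
    rw [← Set.range_comp]
    simp only [Function.comp_def, X_pow_eq_monomial]
  rw [hset, mem_ideal_span_monomial_image]
  simp

theorem coeff_smul_pow_char [CommSemiring R] (p : ℕ) [ExpChar R p] (f : MvPolynomial σ R)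
    (m : σ →₀ ℕ) : (f ^ p).coeff (p • m) = f.coeff m ^ p := by
  rw [← map_frobenius_expand p, coeff_map, coeff_expand_smul p (expChar_ne_zero R p),
    frobenius_def]

theorem exists_eq_smul_of_mem_support_pow_char [CommSemiring R] (p : ℕ) [ExpChar R p]
    {f : MvPolynomial σ R} {m : σ →₀ ℕ} (hm : m ∈ (f ^ p).support) :
    ∃ a ∈ f.support, p • a = m := by
  classical
  rw [← map_frobenius_expand p] at hm
  simpa using support_expand_subset f (support_map_subset _ _ hm)

/-- If `f ∉ (X_i ^ p)_i` and `g ∉ (X_i ^ q)_i` in characteristic `p`, then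
`f * g ^ p ∉ (X_i ^ (p * q))_i`. -/
theorem mul_pow_char_notMem_span_range_X_pow [CommSemiring R] [NoZeroDivisors R]
    (p : ℕ) [ExpChar R p] {q : ℕ} {f g : MvPolynomial σ R}
    (hf : f ∉ Ideal.span (Set.range fun i : σ => (X i : MvPolynomial σ R) ^ p))
    (hg : g ∉ Ideal.span (Set.range fun i : σ => (X i : MvPolynomial σ R) ^ q)) :
    f * g ^ p ∉ Ideal.span (Set.range fun i : σ => (X i : MvPolynomial σ R) ^ (p * q)) := by
  classical
  rw [notMem_span_range_X_pow_iff] at *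
  obtain ⟨a, ha, hap⟩ := hf
  obtain ⟨b, hbg, hbq⟩ := hg
  obtain ⟨c, hcb, hc⟩ := g.support.exists_le_minimal hbg
  have hcq : ∀ i, c i < q := fun i => (hcb i).trans_lt (hbq i)
  refine ⟨a + p • c, ?_, fun i => ?_⟩
  · have hcoeff : (f * g ^ p).coeff (a + p • c) = f.coeff a * g.coeff c ^ p := by
      rw [coeff_mul, Finset.sum_eq_single (a, p • c), coeff_smul_pow_char]
      · rintro ⟨u, v⟩ huv hne
        rw [Finset.HasAntidiagonal.mem_antidiagonal] at huv
        by_contra h0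
        obtain ⟨d, hd, rfl⟩ := exists_eq_smul_of_mem_support_pow_char p
          (mem_support_iff.2 (right_ne_zero_of_mul h0))
        have hdc : d ≤ c := fun i => by
          have h1 : u i + p * d i = a i + p * c i := by simpa using DFunLike.congr_fun huv i
          have h2 : p * d i < p * (c i + 1) := by linarith [hap i, Nat.zero_le (u i)]
          exact Nat.lt_succ_iff.1 (Nat.lt_of_mul_lt_mul_left h2)
        obtain rfl : d = c := le_antisymm hdc (hc.2 hd hdc)
        exact hne (Prod.ext (add_right_cancel huv) rfl)
      · simp
    rw [mem_support_iff, hcoeff]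
    exact mul_ne_zero (mem_support_iff.1 ha) (pow_ne_zero p (mem_support_iff.1 hc.1))
  · calc (a + p • c) i = a i + p * c i := by simp
      _ < p * (c i + 1) := by linarith [hap i]
      _ ≤ p * q := Nat.mul_le_mul_left p (hcq i)

end MvPolynomial

/-- propagation of Fedder-type non-containment to all powers of `p`.
If `h ∈ K[x_1, …, x_n]` (with `K` a perfect field of characteristic `p > 0`) satisfies
`h ∉ (x_1^p, …, x_n^p)`, then for every `e ≥ 1` one has
`h^{1 + p + ⋯ + p^{e−1}} ∉ (x_1^{p^e}, …, x_n^{p^e})`. -/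
theorem stmt_5 (p : ℕ) [Fact p.Prime] (K : Type*) [Field K] [CharP K p] [PerfectRing K p]
    (n : ℕ) (h : MvPolynomial (Fin n) K)
    (hh : h ∉ Ideal.span (Set.range fun k : Fin n => (X k : MvPolynomial (Fin n) K) ^ p))
    (e : ℕ) (he : 1 ≤ e) :
    h ^ (∑ i ∈ Finset.range e, p ^ i) ∉
      Ideal.span (Set.range fun k : Fin n =>
        (X k : MvPolynomial (Fin n) K) ^ p ^ e) := by
  have : ExpChar K p := .prime Fact.out
  induction e, he using Nat.le_induction with
  | base => simpa using hh
  | succ e _ ih =>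
    have hpow : h ^ ∑ i ∈ Finset.range (e + 1), p ^ i =
        h * (h ^ ∑ i ∈ Finset.range e, p ^ i) ^ p := by
      rw [geom_sum_succ, pow_succ', mul_comm p, pow_mul]
    rw [hpow, pow_succ' p e]
    exact mul_pow_char_notMem_span_range_X_pow p hh ih
end

section
/- Let R be a commutative ring of prime characteristic p, let I ⊆ R be an ideal, and let q = p^e and q' = p^{e'} be powers of p. Then (I^{[q]} :_R I) · ((I^{[q']} :_R I))^{[q]} ⊆ (I^{[q q']} :_R I). -/
theorem frobPow_eq_map_iterateFrobenius {R : Type*} [CommRing R] (p : ℕ) [ExpChar R p]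
    (J : Ideal R) (e : ℕ) : frobPow J (p ^ e) = J.map (iterateFrobenius R p e) := rfl

theorem frobPow_mul_exponent {R : Type*} [CommRing R] (p : ℕ) [ExpChar R p]
    (J : Ideal R) (e e' : ℕ) :
    frobPow J (p ^ e * p ^ e') = frobPow (frobPow J (p ^ e')) (p ^ e) := by
  rw [← pow_add]
  simp only [frobPow_eq_map_iterateFrobenius, Ideal.map_map, iterateFrobenius_add]

/-- In a commutative ring `R` of prime characteristic `p`, for an ideal
`I` and powers `q = p^e`, `q' = p^{e'}` of `p`:
`(I^{[q]} : I) · ((I^{[q']} : I))^{[q]} ⊆ (I^{[q q']} : I)`. -/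
theorem stmt_7 (p : ℕ) (hp : p.Prime) (R : Type*) [CommRing R] [CharP R p]
    (I : Ideal R) (e e' : ℕ) :
    (frobPow I (p ^ e)).colon I * frobPow ((frobPow I (p ^ e')).colon I) (p ^ e) ≤
      (frobPow I (p ^ e * p ^ e')).colon I := by
  have : Fact p.Prime := ⟨hp⟩
  have hcolon : (frobPow I (p ^ e')).colon I * I ≤ frobPow I (p ^ e') :=
    Ideal.mul_le.2 fun r hr x hx => Submodule.mem_colon.1 hr x hx
  have hfrob := Ideal.map_mono (f := iterateFrobenius R p e) hcolon
  rw [Ideal.map_mul] at hfrob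
  refine Ideal.mul_le.2 fun s hs t ht => Submodule.mem_colon.2 fun x hx => ?_
  rw [frobPow_mul_exponent, smul_eq_mul, mul_comm s t, mul_assoc]
  exact hfrob (Ideal.mul_mem_mul ht (Submodule.mem_colon.1 hs x hx))
end

section
/- Let p be a prime, let d ≥ 1 with d dividing p − 1, let n ≥ 1 with d ≥ n + 1, and let S = 𝔽_p[x_0, x_1, …, x_n] and f = x_0^d + x_1^d + ⋯ + x_n^d ∈ S. Let m ≥ 1 be an integer and z ∈ S. If f^{p−1} · z^p lies in the ideal (x_0^{mp}, x_1^{mp}, …, x_n^{mp}) of S, then 𝔪^{d−n−1} · z ⊆ (x_0^m, x_1^m, …, x_n^m), where 𝔪 = (x_0, x_1, …, x_n). -/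
open MvPolynomial

theorem mem_span_range_X_pow_iff {σ R : Type*} [CommSemiring R] {k : ℕ} {x : MvPolynomial σ R} :
    x ∈ Ideal.span (Set.range fun i : σ => (X i : MvPolynomial σ R) ^ k) ↔
      ∀ e ∈ x.support, ∃ i, k ≤ e i := by
  have h : (Set.range fun i : σ => (X i : MvPolynomial σ R) ^ k) =
      (fun s => monomial s (1 : R)) '' Set.range fun i => Finsupp.single i k := by
    rw [← Set.range_comp]
    congr 1
    ext1 i
    simp [X_pow_eq_monomial]
  simp [h, mem_ideal_span_monomial_image]

theorem Nat.Prime.not_dvd_finsuppMultinomial {α : Type*} {p : ℕ} (hp : p.Prime) {a : α →₀ ℕ}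
    (ha : (a.sum fun _ k => k) < p) : ¬ p ∣ a.multinomial := by
  intro h
  have h' : p ∣ (∑ i ∈ a.support, a i).factorial := by
    rw [← Nat.multinomial_spec, ← Finsupp.multinomial_eq]
    exact h.mul_left _
  exact absurd (hp.dvd_factorial.1 h') (not_le.2 ha)

/-- If every exponent of `q` is less than `p`, then distinct pairs of monomials of `q` and `z`
contribute to distinct monomials of `q(x ^ d) * z(x ^ p)`. -/
theorem coeff_expand_mul_expand {σ R : Type*} [CommSemiring R] {d p : ℕ} (hd : d ≠ 0)
    (hp : p ≠ 0) (hdp : d.Coprime p) (q z : MvPolynomial σ R) (hq : ∀ b ∈ q.support, ∀ i, b i < p)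
    {a : σ →₀ ℕ} (ha : ∀ i, a i < p) (e : σ →₀ ℕ) :
    coeff (d • a + p • e) (expand d q * expand p z) = coeff a q * coeff e z := by
  classical
  rw [coeff_mul, Finset.sum_eq_single (d • a, p • e)]
  · simp only [coeff_expand_smul _ hd, coeff_expand_smul _ hp]
  · rintro ⟨s, t⟩ hst hne
    by_contra h
    have hs := support_expand_subset q (mem_support_iff.2 (left_ne_zero_of_mul h))
    have ht := support_expand_subset z (mem_support_iff.2 (right_ne_zero_of_mul h))
    obtain ⟨b, hb, rfl⟩ := Finset.mem_image.1 hs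
    obtain ⟨c, -, rfl⟩ := Finset.mem_image.1 ht
    have hbc := Finset.HasAntidiagonal.mem_antidiagonal.1 hst
    have hba : b = a := by
      ext i
      have hi : d * b i + p * c i = d * a i + p * e i := by
        simpa using DFunLike.congr_fun hbc i
      have hmod : d * b i ≡ d * a i [MOD p] := by
        simpa [Nat.ModEq] using congrArg (· % p) hi
      exact (hmod.cancel_left_of_coprime hdp.symm).eq_of_lt_of_lt (hq b hb i) (ha i)
    subst hba
    exact hne (Prod.ext rfl (add_left_cancel hbc))
  · intro h
    simp at h

/-- main computation in Example 2.10, for the Fermat hypersurface of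
degree `d` in `ℙ^n` over `𝔽_p` with `d ∣ p − 1` and `d ≥ n + 1`. If
`f = x_0^d + ⋯ + x_n^d` and `f^{p−1} z^p ∈ (x_0^{mp}, …, x_n^{mp})`, then
`𝔪^{d−n−1} · z ⊆ (x_0^m, …, x_n^m)` where `𝔪 = (x_0, …, x_n)`. -/
theorem stmt_10 (p : ℕ) (hp : p.Prime) (d n : ℕ) (hd : 1 ≤ d) (hdvd : d ∣ p - 1)
    (hn : 1 ≤ n) (hdn : n + 1 ≤ d) (m : ℕ) (hm : 1 ≤ m)
    (z : MvPolynomial (Fin (n + 1)) (ZMod p))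
    (hz : (∑ i, X i ^ d : MvPolynomial (Fin (n + 1)) (ZMod p)) ^ (p - 1) * z ^ p ∈
      Ideal.span (Set.range fun i : Fin (n + 1) =>
        (X i : MvPolynomial (Fin (n + 1)) (ZMod p)) ^ (m * p))) :
    ∀ w ∈ (Ideal.span (Set.range (X : Fin (n + 1) →
        MvPolynomial (Fin (n + 1)) (ZMod p)))) ^ (d - (n + 1)),
      w * z ∈ Ideal.span (Set.range fun i : Fin (n + 1) =>
        (X i : MvPolynomial (Fin (n + 1)) (ZMod p)) ^ m) := by
  have : Fact p.Prime := ⟨hp⟩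
  obtain ⟨k, hk⟩ := hdvd
  have hp2 := hp.two_le
  have hpk : p = d * k + 1 := by omega
  have hk0 : 0 < k := Nat.pos_of_ne_zero (by rintro rfl; omega)
  have hdp : d ≤ p - 1 := hk ▸ Nat.le_mul_of_pos_right d hk0
  have hcop : d.Coprime p := by rw [hpk]; simp
  have hexp : (∑ i, X i ^ d : MvPolynomial (Fin (n + 1)) (ZMod p)) ^ (p - 1) * z ^ p =
      expand d ((∑ i, X i) ^ (p - 1)) * expand p z := by
    simp [expand_zmod]
  rw [hexp, mem_span_range_X_pow_iff] at hz
  intro w hw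
  rw [pow_idealOfVars_eq_span] at hw
  induction hw using Submodule.span_induction with
  | zero => simp
  | add x y _ _ hx hy => rw [add_mul]; exact add_mem hx hy
  | smul c x _ hx => rw [smul_eq_mul, mul_assoc]; exact Ideal.mul_mem_left _ _ hx
  | mem x hx =>
    obtain ⟨u, hu, rfl⟩ := hx
    have hu : u.degree = d - (n + 1) := hu
    rw [mem_span_range_X_pow_iff]
    intro v hv
    rw [mem_support_iff, coeff_monomial_mul'] at hv
    have huv : u ≤ v := by by_contra h; simp [h] at hv
    obtain ⟨e, rfl⟩ := exists_add_of_le huv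
    have he : coeff e z ≠ 0 := by simpa using hv
    by_contra! hlt
    have hui : ∀ i, u i < d := fun i => by
      have := u.le_degree i
      omega
    let a : Fin (n + 1) →₀ ℕ := Finsupp.equivFunOnFinite.symm fun i => k * (u i + 1)
    have ha : ∀ i, a i = k * (u i + 1) := fun _ => rfl
    have hasum : (a.sum fun _ j => j) = p - 1 := by
      rw [Finsupp.degree_eq_sum] at hu
      rw [Finsupp.sum_fintype _ _ fun _ => rfl]
      simp only [ha]
      rw [← Finset.mul_sum, Finset.sum_add_distrib, hu, hk]
      simp [Nat.sub_add_cancel hdn, mul_comm]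
    have hlt_p : ∀ b : Fin (n + 1) →₀ ℕ, (b.sum fun _ j => j) = p - 1 → ∀ i, b i < p := by
      intro b hb i
      have : b i ≤ b.degree := b.le_degree i
      change b.degree = _ at hb
      omega
    have hq : ∀ b ∈ ((∑ i, X i : MvPolynomial (Fin (n + 1)) (ZMod p)) ^ (p - 1)).support,
        ∀ i, b i < p := by
      intro b hb
      rw [mem_support_iff, coeff_sum_X_pow_of_fintype] at hb
      exact hlt_p b (by by_contra h; simp [h] at hb)
    obtain ⟨i, hi⟩ := hz (d • a + p • e) <| by
      rw [mem_support_iff, coeff_expand_mul_expand (by omega) hp.ne_zero hcop _ z hq (hlt_p a hasum),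
        coeff_sum_X_pow_of_fintype, if_pos hasum]
      refine mul_ne_zero ?_ he
      rw [Ne, ZMod.natCast_eq_zero_iff]
      exact hp.not_dvd_finsuppMultinomial (by omega)
    have hi' : m * p ≤ d * (k * (u i + 1)) + p * e i := by simpa [ha] using hi
    have hlti : u i + e i + 1 ≤ m := hlt i
    have := Nat.mul_le_mul_right p hlti
    have : d * (k * (u i + 1)) + (u i + 1) = p * (u i + 1) := by rw [hpk]; ring
    nlinarith
end

section
/- Let p be a prime and let S = 𝔽_p[x_1, x_2, x_3, y_1, y_2, y_3]. Let 𝔞 = (x_1 y_2 − x_2 y_1, x_2 y_3 − x_3 y_2, x_1 y_3 − x_3 y_1) and 𝔪 = (x_1, x_2, x_3, y_1, y_2, y_3). Then for every integer e ≥ 1, setting q = p^e, one has 𝔞^{2(q−1)} ⊄ (x_1^q, x_2^q, x_3^q, y_1^q, y_2^q, y_3^q) and 𝔞^{2(q−1)+1} ⊆ (x_1^q, x_2^q, x_3^q, y_1^q, y_2^q, y_3^q). -/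
open MvPolynomial

/-- A power of an ideal with three generators is contained in any ideal that contains all
products of the generators of the right total degree. -/
lemma span_triple_pow_le {R : Type*} [CommRing R] (a b c : R) (n : ℕ) (I : Ideal R)
    (h : ∀ i j k, i + j + k = n → a ^ i * b ^ j * c ^ k ∈ I) :
    (Ideal.span {a, b, c} : Ideal R) ^ n ≤ I := by
  have key : (Ideal.span {a, b, c} : Ideal R) ^ n ≤
      Ideal.span {x | ∃ i j k, i + j + k = n ∧ x = a ^ i * b ^ j * c ^ k} := by
    clear h
    induction n with
    | zero =>
      rw [pow_zero, Ideal.one_eq_top, top_le_iff, Ideal.eq_top_iff_one]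
      exact Ideal.subset_span ⟨0, 0, 0, rfl, by simp⟩
    | succ n ih =>
      rw [pow_succ]
      refine (Ideal.mul_mono_left ih).trans ?_
      rw [Ideal.span_mul_span', Ideal.span_le]
      rintro _ ⟨_, ⟨i, j, k, rfl, rfl⟩, y, hy, rfl⟩
      apply Ideal.subset_span
      rcases hy with rfl | rfl | rfl
      · exact ⟨i + 1, j, k, by ring, by ring⟩
      · exact ⟨i, j + 1, k, by ring, by ring⟩
      · exact ⟨i, j, k + 1, by ring, by ring⟩
  refine key.trans (Ideal.span_le.2 ?_)
  rintro _ ⟨i, j, k, hn, rfl⟩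
  exact h i j k hn

/-- Pigeonhole: if `x * b` is a combination of `a` and `c`, then `x ^ q` multiplies every product
of at least `2 * q - 1` factors among `a`, `b`, `c` into any ideal containing the `q`-th powers. -/
lemma pow_mul_prod_mem {R : Type*} [CommRing R] {I : Ideal R} {a b c x u v : R} {q i j k : ℕ}
    (hx : x * b = u * a + v * c) (ha : a ^ q ∈ I) (hb : b ^ q ∈ I) (hc : c ^ q ∈ I)
    (hn : 2 * q ≤ i + j + k + 1) : x ^ q * (a ^ i * b ^ j * c ^ k) ∈ I := by
  by_cases hj : q ≤ j
  · exact I.mul_mem_left _ (I.mul_mem_right _ (I.mul_mem_left _ (I.pow_mem_of_pow_mem hb hj)))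
  have h : x ^ q * (a ^ i * b ^ j * c ^ k) =
      x ^ (q - j) * (a ^ i * c ^ k * (u * a + v * c) ^ j) := by
    rw [← hx, mul_pow, ← Nat.sub_add_cancel (le_of_not_ge hj), pow_add, Nat.add_sub_cancel]
    ring
  rw [h, add_pow, Finset.mul_sum]
  refine I.mul_mem_left _ (I.sum_mem fun m hm => ?_)
  have hm' : m ≤ j := Nat.lt_succ_iff.1 (Finset.mem_range.1 hm)
  have h' : a ^ i * c ^ k * ((u * a) ^ m * (v * c) ^ (j - m) * (j.choose m : R)) =
      (u ^ m * v ^ (j - m) * (j.choose m : R)) * (a ^ (i + m) * c ^ (k + (j - m))) := by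
    ring
  rw [h']
  refine I.mul_mem_left _ ?_
  by_cases hq : q ≤ i + m
  · exact I.mul_mem_right _ (I.pow_mem_of_pow_mem ha hq)
  · exact I.mul_mem_left _ (I.pow_mem_of_pow_mem hc (by omega))

lemma mem_span_range_X_pow {σ R : Type*} [CommSemiring R] {q : ℕ} {f : MvPolynomial σ R} :
    f ∈ Ideal.span (Set.range fun i : σ => (X i : MvPolynomial σ R) ^ q) ↔
      ∀ n ∈ f.support, ∃ i, q ≤ n i := by
  have h : (Set.range fun i : σ => (X i : MvPolynomial σ R) ^ q) =
      (fun n => monomial n (1 : R)) '' Set.range fun i : σ => Finsupp.single i q := by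
    rw [← Set.range_comp]
    simp [Function.comp_def, X_pow_eq_monomial]
  simp [h, mem_ideal_span_monomial_image]

/-- The ideal generated by the products `X i ^ q * X j ^ q` with `i ≠ j`. -/
noncomputable def distinctPowIdeal (σ R : Type*) [CommSemiring R] (q : ℕ) : Ideal (MvPolynomial σ R) :=
  Ideal.span ((fun n => monomial n (1 : R)) ''
    {n | ∃ i j, i ≠ j ∧ n = Finsupp.single i q + Finsupp.single j q})

lemma X_mul_X_pow_mem_distinctPowIdeal {σ R : Type*} [CommSemiring R] (q : ℕ) {i j : σ}
    (h : i ≠ j) : ((X i * X j : MvPolynomial σ R)) ^ q ∈ distinctPowIdeal σ R q := by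
  refine Ideal.subset_span ⟨_, ⟨i, j, h, rfl⟩, ?_⟩
  simp [mul_pow, X_pow_eq_monomial, monomial_mul]

lemma mem_span_range_X_pow_of_X_pow_mul_mem {σ R : Type*} [CommSemiring R] {q : ℕ} {k : σ}
    {f : MvPolynomial σ R} (h : X k ^ q * f ∈ distinctPowIdeal σ R q) :
    f ∈ Ideal.span (Set.range fun i : σ => (X i : MvPolynomial σ R) ^ q) := by
  classical
  rw [mem_span_range_X_pow]
  intro n hn
  rw [distinctPowIdeal, mem_ideal_span_monomial_image] at h
  obtain ⟨_, ⟨i, j, hij, rfl⟩, hle⟩ := h (Finsupp.single k q + n) (by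
    rw [mem_support_iff, X_pow_eq_monomial, coeff_monomial_mul, one_mul]
    exact mem_support_iff.1 hn)
  have hi := hle i
  have hj := hle j
  simp only [Finsupp.add_apply, Finsupp.single_apply, if_neg hij, if_neg hij.symm,
    if_true] at hi hj
  by_cases hk : k = i
  · refine ⟨j, ?_⟩
    rw [if_neg (hk ▸ hij)] at hj
    omega
  · refine ⟨i, ?_⟩
    rw [if_neg hk] at hi
    omega

theorem stmt_13 (p : ℕ) (hp : p.Prime) (e : ℕ) (he : 1 ≤ e) :
    ¬((Ideal.span {X 0 * X 4 - X 1 * X 3, X 1 * X 5 - X 2 * X 4, X 0 * X 5 - X 2 * X 3} :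
        Ideal (MvPolynomial (Fin 6) (ZMod p))) ^ (2 * (p ^ e - 1)) ≤
      Ideal.span (Set.range fun i : Fin 6 =>
        (X i : MvPolynomial (Fin 6) (ZMod p)) ^ p ^ e)) ∧
    (Ideal.span {X 0 * X 4 - X 1 * X 3, X 1 * X 5 - X 2 * X 4, X 0 * X 5 - X 2 * X 3} :
        Ideal (MvPolynomial (Fin 6) (ZMod p))) ^ (2 * (p ^ e - 1) + 1) ≤
      Ideal.span (Set.range fun i : Fin 6 =>
        (X i : MvPolynomial (Fin 6) (ZMod p)) ^ p ^ e) := by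
  have : Fact p.Prime := ⟨hp⟩
  have hq : 0 < p ^ e := pow_pos hp.pos e
  constructor
  · intro hle
    have hmem : ((X 0 * X 4 - X 1 * X 3) ^ (p ^ e - 1) * (X 1 * X 5 - X 2 * X 4) ^ (p ^ e - 1) :
        MvPolynomial (Fin 6) (ZMod p)) ∈
        Ideal.span (Set.range fun i : Fin 6 =>
          (X i : MvPolynomial (Fin 6) (ZMod p)) ^ p ^ e) := by
      apply hle
      rw [two_mul, pow_add]
      exact Ideal.mul_mem_mul (Ideal.pow_mem_pow (Ideal.subset_span (by simp)) _)
        (Ideal.pow_mem_pow (Ideal.subset_span (by simp)) _)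
    -- Setting `x₃ = y₁ = 0` turns the two minors into monomials.
    let φ : MvPolynomial (Fin 6) (ZMod p) →ₐ[ZMod p] MvPolynomial (Fin 6) (ZMod p) :=
      aeval fun i => if i = 2 ∨ i = 3 then 0 else X i
    have hφ := Ideal.mem_map_of_mem φ hmem
    rw [Ideal.map_span] at hφ
    have hspan : Ideal.span (φ '' Set.range fun i : Fin 6 =>
        (X i : MvPolynomial (Fin 6) (ZMod p)) ^ p ^ e) ≤
        Ideal.span (Set.range fun i : Fin 6 =>
          (X i : MvPolynomial (Fin 6) (ZMod p)) ^ p ^ e) := by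
      rw [Ideal.span_le]
      rintro _ ⟨_, ⟨i, rfl⟩, rfl⟩
      by_cases hi : i = 2 ∨ i = 3
      · simp [φ, hi, zero_pow hq.ne']
      · simpa [φ, hi] using Ideal.subset_span (Set.mem_range_self i)
    have hφ' := mem_span_range_X_pow.1 (hspan hφ)
    have hmon : φ ((X 0 * X 4 - X 1 * X 3) ^ (p ^ e - 1) *
        (X 1 * X 5 - X 2 * X 4) ^ (p ^ e - 1)) =
        monomial (Finsupp.single 0 (p ^ e - 1) + Finsupp.single 4 (p ^ e - 1) +
          (Finsupp.single 1 (p ^ e - 1) + Finsupp.single 5 (p ^ e - 1))) 1 := by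
      simp [φ, mul_pow, X_pow_eq_monomial, monomial_mul]
    obtain ⟨i, hi⟩ := hφ' _ (by rw [hmon, mem_support_iff, coeff_monomial, if_pos rfl]; simp)
    have hp0 := hp.pos
    fin_cases i <;> simp at hi <;> omega
  · have hsub : ∀ i j k l : Fin 6, i ≠ j → k ≠ l →
        (X i * X j - X k * X l : MvPolynomial (Fin 6) (ZMod p)) ^ p ^ e ∈
          distinctPowIdeal (Fin 6) (ZMod p) (p ^ e) := by
      intro i j k l hij hkl
      rw [sub_pow_char_pow]
      exact Ideal.sub_mem _ (X_mul_X_pow_mem_distinctPowIdeal _ hij)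
        (X_mul_X_pow_mem_distinctPowIdeal _ hkl)
    refine span_triple_pow_le _ _ _ _ _ fun i j k hn =>
      mem_span_range_X_pow_of_X_pow_mul_mem (k := 0) ?_
    exact pow_mul_prod_mem (u := -X 2) (v := X 1) (by ring)
      (hsub _ _ _ _ (by decide) (by decide)) (hsub _ _ _ _ (by decide) (by decide))
      (hsub _ _ _ _ (by decide) (by decide)) (by omega)
end
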